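/- arXiv:2402.18260 — 3 statements merged into one kernel-verified Lean document; each statement's English description precedes it below -/
import Mathlib

section
/- Let 0 < α ≤ 1/2 and ε ∈ (0,1). Let (M_r)_{r≥1} be a strictly increasing sequence of positive integers, let p ∈ [0,1] with p ≥ α, and on a probability space (Ω, Q) let (Y_r)_{r≥1} be random variables such that for each r the law of Y_r is the binomial distribution with M_r trials and success probability p. With c_r = sqrt((2/M_r)·|log(6ε/(π²r²))|), the probability Q( ∃ r ∈ ℕ, Y_r/M_r + sqrt(α(1−α))·c_r < α ) is at most ε. -/
open MeasureTheory ProbabilityTheory Real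

/-- `Y` has the binomial distribution with `M` trials and success probability `p`
under the probability measure `Q`. -/
def IsBinomial {Ω : Type*} [MeasurableSpace Ω] (Q : Measure Ω) (Y : Ω → ℕ)
    (M : ℕ) (p : ℝ) : Prop :=
  Measurable Y ∧ (∀ ω, Y ω ≤ M) ∧
    ∀ k : ℕ, Q {ω | Y ω = k} = ENNReal.ofReal ((M.choose k : ℝ) * p ^ k * (1 - p) ^ (M - k))

/-- A function with nonpositive derivative on `[0, ∞)` stays there below its
initial value. -/
lemma le_zero_value_of_deriv_nonpos {f f' : ℝ → ℝ} (hf : ∀ x, HasDerivAt f (f' x) x)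
    (hf' : ∀ x, 0 ≤ x → f' x ≤ 0) {s : ℝ} (hs : 0 ≤ s) : f s ≤ f 0 := by
  refine antitoneOn_of_deriv_nonpos (convex_Ici 0) ?_ ?_ ?_ Set.self_mem_Ici hs hs
  · exact fun x _ => (hf x).continuousAt.continuousWithinAt
  · exact fun x _ => (hf x).differentiableAt.differentiableWithinAt
  · intro x hx
    rw [interior_Ici] at hx
    exact (hf x).deriv ▸ hf' x (le_of_lt hx)

lemma exp_mul_one_sub_le {α s : ℝ} (hα0 : 0 ≤ α) (hα : α ≤ 1 / 2) (hs : 0 ≤ s) :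
    exp s * (1 - (1 - α) * s) ≤ 1 + α * s := by
  have key := le_zero_value_of_deriv_nonpos (s := s)
    (f := fun x => exp x * (1 - (1 - α) * x) - α * x)
    (f' := fun x => exp x * (α - (1 - α) * x) - α) ?_ ?_ hs
  · simp only [exp_zero] at key
    linarith
  · intro x
    have h := ((hasDerivAt_exp x).mul (((hasDerivAt_id x).const_mul (1 - α)).const_sub 1)).sub
      ((hasDerivAt_id x).const_mul α)
    refine h.congr_deriv ?_
    simp only [id]
    ring
  · intro x hx
    have h1 : α - (1 - α) * x ≤ α * exp (-x) := by
      nlinarith [mul_le_mul_of_nonneg_left (add_one_le_exp (-x)) hα0]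
    have h2 := mul_le_mul_of_nonneg_left h1 (exp_pos x).le
    have h3 : exp x * exp (-x) = 1 := by rw [← exp_add]; simp
    linear_combination h2 + α * h3

/-- For `α ≤ 1 / 2`, the left tail of a centred Bernoulli variable is sub-Gaussian with its own
variance `α * (1 - α)` as variance proxy. -/
lemma bernoulli_mgf_neg_le {α s : ℝ} (hα0 : 0 ≤ α) (hα : α ≤ 1 / 2) (hs : 0 ≤ s) :
    1 - α + α * exp (-s) ≤ exp (-(α * s) + α * (1 - α) * s ^ 2 / 2) := by
  have key := le_zero_value_of_deriv_nonpos (s := s)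
    (f := fun x => (1 - α + α * exp (-x)) * exp (α * x - α * (1 - α) * x ^ 2 / 2))
    (f' := fun x => (-(α * exp (-x)) + (1 - α + α * exp (-x)) * (α - α * (1 - α) * x)) *
      exp (α * x - α * (1 - α) * x ^ 2 / 2)) ?_ ?_ hs
  · have h : (1 - α + α * exp (-s)) * exp (α * s - α * (1 - α) * s ^ 2 / 2) ≤ 1 := by
      simpa using key
    rw [show -(α * s) + α * (1 - α) * s ^ 2 / 2 = -(α * s - α * (1 - α) * s ^ 2 / 2) by ring,
      exp_neg (_ - _), ← one_div]
    exact (le_div_iff₀ (exp_pos _)).2 h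
  · intro x
    have h1 := (((hasDerivAt_id x).neg.exp).const_mul α).const_add (1 - α)
    have h2 := (((hasDerivAt_id x).const_mul α).sub
      ((((hasDerivAt_id x).pow 2).const_mul (α * (1 - α))).div_const 2)).exp
    refine (h1.mul h2).congr_deriv ?_
    simp
    ring
  · intro x hx
    refine mul_nonpos_of_nonpos_of_nonneg ?_ (exp_pos _).le
    have h1 := mul_le_mul_of_nonneg_left (exp_mul_one_sub_le hα0 hα hx) (exp_pos (-x)).le
    have h2 : exp (-x) * exp x = 1 := by rw [← exp_add]; simp
    have h3 : 1 - (1 - α) * x ≤ exp (-x) * (1 + α * x) := by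
      linear_combination h1 - (1 - (1 - α) * x) * h2
    have h4 := mul_le_mul_of_nonneg_left h3 (mul_nonneg hα0 (by linarith : 0 ≤ 1 - α))
    linear_combination h4

/-- Chernoff bound for the lower tail of a binomial variable. -/
lemma IsBinomial.measure_lt_le {Ω : Type*} [MeasurableSpace Ω] {Q : Measure Ω} {Y : Ω → ℕ}
    {M : ℕ} {p : ℝ} (hY : IsBinomial Q Y M p) (hp0 : 0 ≤ p) (hp1 : p ≤ 1) {s : ℝ} (hs : 0 ≤ s)
    (x : ℝ) :
    Q {ω | (Y ω : ℝ) < x} ≤ ENNReal.ofReal (exp (s * x) * (1 - p + p * exp (-s)) ^ M) := by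
  obtain ⟨-, hle, hpmf⟩ := hY
  have hq : 0 ≤ 1 - p := by linarith
  set S := (Finset.range (M + 1)).filter fun k : ℕ => (k : ℝ) < x with hS
  have hsub : {ω | (Y ω : ℝ) < x} ⊆ ⋃ k ∈ S, {ω | Y ω = k} := by
    intro ω hω
    simpa [hS, Nat.lt_succ_iff, hle ω] using hω
  have hsum : exp (s * x) * (1 - p + p * exp (-s)) ^ M = ∑ k ∈ Finset.range (M + 1),
      (M.choose k : ℝ) * p ^ k * (1 - p) ^ (M - k) * exp (s * (x - k)) := by
    rw [add_comm (1 - p), add_pow, Finset.mul_sum]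
    refine Finset.sum_congr rfl fun k _ => ?_
    rw [mul_pow, ← exp_nat_mul, show s * (x - k) = s * x + k * -s by ring, exp_add]
    ring
  calc Q {ω | (Y ω : ℝ) < x} ≤ ∑ k ∈ S, Q {ω | Y ω = k} :=
        (measure_mono hsub).trans (measure_biUnion_finset_le _ _)
    _ = ENNReal.ofReal (∑ k ∈ S, (M.choose k : ℝ) * p ^ k * (1 - p) ^ (M - k)) := by
        rw [ENNReal.ofReal_sum_of_nonneg fun k _ => by positivity]
        exact Finset.sum_congr rfl fun k _ => hpmf k
    _ ≤ _ := by
        refine ENNReal.ofReal_le_ofReal ?_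
        rw [hsum]
        calc _ ≤ ∑ k ∈ S, (M.choose k : ℝ) * p ^ k * (1 - p) ^ (M - k) * exp (s * (x - k)) := by
              refine Finset.sum_le_sum fun k hk => le_mul_of_one_le_right (by positivity) ?_
              have hkx : (k : ℝ) < x := (Finset.mem_filter.1 hk).2
              exact one_le_exp (mul_nonneg hs (by linarith))
          _ ≤ _ := Finset.sum_le_sum_of_subset_of_nonneg (Finset.filter_subset _ _)
              fun k _ _ => by positivity

/-- Okamoto's bound: a binomial frequency with success probability at least `α ≤ 1 / 2` falls
short of `α` by `c` standard deviations with sub-Gaussian probability. -/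
lemma IsBinomial.measure_div_add_sqrt_mul_lt_le {Ω : Type*} [MeasurableSpace Ω] {Q : Measure Ω}
    {Y : Ω → ℕ} {M : ℕ} {p α c : ℝ} (hY : IsBinomial Q Y M p) (hM : 0 < M) (hα0 : 0 < α)
    (hα : α ≤ 1 / 2) (hp1 : p ≤ 1) (hpα : α ≤ p) (hc : 0 ≤ c) :
    Q {ω | (Y ω : ℝ) / M + √(α * (1 - α)) * c < α} ≤ ENNReal.ofReal (exp (-(M * c ^ 2 / 2))) := by
  have hv : 0 < α * (1 - α) := mul_pos hα0 (by linarith)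
  set σ := √(α * (1 - α)) with hσ
  have hσ0 : 0 < σ := sqrt_pos.2 hv
  have hσ2 : α * (1 - α) = σ ^ 2 := (sq_sqrt hv.le).symm
  have hM' : (0 : ℝ) < M := Nat.cast_pos.2 hM
  set s := c / σ with hs_def
  have hs : 0 ≤ s := by positivity
  have hset : {ω | (Y ω : ℝ) / M + σ * c < α} = {ω | (Y ω : ℝ) < (α - σ * c) * M} := by
    ext ω
    simp only [Set.mem_ofPred_eq, ← lt_sub_iff_add_lt, div_lt_iff₀ hM']
  rw [hset]
  refine (hY.measure_lt_le (hα0.le.trans hpα) hp1 hs _).trans (ENNReal.ofReal_le_ofReal ?_)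
  have hexp : exp (-s) ≤ 1 := exp_le_one_iff.2 (by linarith)
  have hbase : 1 - p + p * exp (-s) ≤ exp (-(α * s) + α * (1 - α) * s ^ 2 / 2) := by
    nlinarith [bernoulli_mgf_neg_le hα0.le hα hs]
  have hbase0 : 0 ≤ 1 - p + p * exp (-s) :=
    add_nonneg (by linarith) (mul_nonneg (hα0.le.trans hpα) (exp_pos _).le)
  calc _ ≤ exp (s * ((α - σ * c) * M)) * exp (-(α * s) + α * (1 - α) * s ^ 2 / 2) ^ M := by
        gcongr
    _ = exp (-(M * c ^ 2 / 2)) := by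
        rw [← exp_nat_mul, ← exp_add, hσ2, hs_def]
        congr 1
        field_simp
        ring

/-- Theorem 1, first part: if the true unsafety probability `p` is at least the safety
threshold `α`, the adaptive Monte-Carlo test falsely declares safety with probability
at most `ε`. -/
theorem adaptive_MC_safe {Ω : Type*} [MeasurableSpace Ω] (Q : Measure Ω)
    [IsProbabilityMeasure Q] (α ε p : ℝ)
    (hα0 : 0 < α) (hα : α ≤ 1 / 2) (hε : ε ∈ Set.Ioo (0 : ℝ) 1)
    (hp0 : 0 ≤ p) (hp1 : p ≤ 1) (hpα : α ≤ p)
    (M : ℕ → ℕ) (hM : StrictMono M) (hMpos : ∀ r, 1 ≤ r → 0 < M r)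
    (Y : ℕ → Ω → ℕ) (hY : ∀ r, 1 ≤ r → IsBinomial Q (Y r) (M r) p)
    (c : ℕ → ℝ)
    (hc : ∀ r, c r = Real.sqrt ((2 / (M r : ℝ)) * |Real.log (6 * ε / (π ^ 2 * (r : ℝ) ^ 2))|)) :
    Q {ω | ∃ r : ℕ, 1 ≤ r ∧
        (Y r ω : ℝ) / (M r : ℝ) + Real.sqrt (α * (1 - α)) * c r < α}
      ≤ ENNReal.ofReal ε := by
  have hε0 : 0 < ε := hε.1
  have hsummand (r : ℕ) : Q {ω | 1 ≤ r ∧ (Y r ω : ℝ) / (M r : ℝ) + √(α * (1 - α)) * c r < α} ≤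
      ENNReal.ofReal (6 * ε / π ^ 2 * (1 / (r : ℝ) ^ 2)) := by
    rcases Nat.eq_zero_or_pos r with rfl | hr
    · simp
    have hr1 : (1 : ℝ) ≤ r := Nat.one_le_cast.2 hr
    have hMr : (0 : ℝ) < M r := Nat.cast_pos.2 (hMpos r hr)
    have hx0 : 0 < 6 * ε / (π ^ 2 * (r : ℝ) ^ 2) := by positivity
    have hx1 : 6 * ε / (π ^ 2 * (r : ℝ) ^ 2) ≤ 1 := by
      rw [div_le_one (by positivity)]
      have hr2 : (1 : ℝ) ≤ (r : ℝ) ^ 2 := one_le_pow₀ hr1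
      nlinarith [hε.2, pi_gt_three]
    have hexp : exp (-(M r * c r ^ 2 / 2)) = 6 * ε / π ^ 2 * (1 / (r : ℝ) ^ 2) := by
      rw [hc r, sq_sqrt (by positivity), abs_of_nonpos (log_nonpos hx0.le hx1),
        show ∀ l : ℝ, -((M r : ℝ) * (2 / M r * -l) / 2) = l by intro l; field_simp, exp_log hx0]
      ring
    rw [← hexp]
    exact (measure_mono fun ω hω => hω.2).trans <|
      (hY r hr).measure_div_add_sqrt_mul_lt_le (hMpos r hr) hα0 hα hp1 hpα (hc r ▸ sqrt_nonneg _)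
  have hsum : HasSum (fun r : ℕ => 6 * ε / π ^ 2 * (1 / (r : ℝ) ^ 2)) ε := by
    have h := hasSum_zeta_two.mul_left (6 * ε / π ^ 2)
    rwa [show 6 * ε / π ^ 2 * (π ^ 2 / 6) = ε by field_simp] at h
  rw [Set.ofPred_exists]
  calc _ ≤ ∑' r : ℕ, ENNReal.ofReal (6 * ε / π ^ 2 * (1 / (r : ℝ) ^ 2)) :=
        (measure_iUnion_le _).trans (ENNReal.tsum_le_tsum hsummand)
    _ = ENNReal.ofReal ε := by
        rw [← ENNReal.ofReal_tsum_of_nonneg (fun r => by positivity) hsum.summable, hsum.tsum_eq]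
end

section
/- Let 0 < α ≤ 1/2 and ε ∈ (0,1). Let (M_r)_{r≥1} be a strictly increasing sequence of positive integers, let p ∈ [0,1] with p ≤ α, and on a probability space (Ω, Q) let (Y_r)_{r≥1} be random variables such that for each r the law of Y_r is the binomial distribution with M_r trials and success probability p. With c_r = sqrt((2/M_r)·|log(6ε/(π²r²))|), the probability Q( ∃ r ∈ ℕ, Y_r/M_r − c_r²/4 − c_r·sqrt(α) > α ) is at most ε. -/
open MeasureTheory ProbabilityTheory Real

lemma add_sq_div_two_le_neg_log_one_sub {v : ℝ} (hv0 : 0 ≤ v) (hv1 : v < 1) :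
    v + v ^ 2 / 2 ≤ -Real.log (1 - v) := by
  have h := Real.hasSum_pow_div_log_of_abs_lt_one (by rwa [abs_of_nonneg hv0])
  have h2 := sum_le_hasSum (Finset.range 2) (fun i _ => by positivity) h
  norm_num [Finset.sum_range_succ] at h2
  linarith

/-- A quadratic lower bound, in the square roots `y` and `t` of the two means, for the
Poisson rate function. -/
lemma two_mul_sub_sq_le_poisson_rate {t y : ℝ} (ht : 0 < t) (hty : t ≤ y) :
    2 * (y - t) ^ 2 ≤ 2 * y ^ 2 * Real.log (y / t) - y ^ 2 + t ^ 2 := by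
  have hy : 0 < y := ht.trans_le hty
  have h := add_sq_div_two_le_neg_log_one_sub (v := 1 - t / y)
    (by rw [sub_nonneg, div_le_one hy]; exact hty) (by linarith [div_pos ht hy])
  rw [sub_sub_cancel, ← Real.log_inv, inv_div] at h
  have h2 := mul_le_mul_of_nonneg_left h (by positivity : 0 ≤ 2 * y ^ 2)
  have h3 : 2 * y ^ 2 * (1 - t / y + (1 - t / y) ^ 2 / 2) = 2 * (y - t) ^ 2 + y ^ 2 - t ^ 2 := by
    field_simp
    ring
  linarith

section

variable {Ω : Type*} [MeasurableSpace Ω] {Q : Measure Ω} {Y : Ω → ℕ} {M : ℕ} {p : ℝ}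

/-- The Chernoff bound for the upper tail of a binomial random variable. -/
lemma IsBinomial.measure_lt_le_chernoff (hY : IsBinomial Q Y M p) (hp0 : 0 ≤ p) (hp1 : p ≤ 1)
    {s : ℝ} (hs : 0 ≤ s) (a : ℝ) :
    Q {ω | a < Y ω} ≤ ENNReal.ofReal ((p * Real.exp s + (1 - p)) ^ M * Real.exp (-(s * a))) := by
  obtain ⟨-, hle, hlaw⟩ := hY
  have hq : 0 ≤ 1 - p := sub_nonneg.2 hp1
  have hsub : {ω | a < Y ω} ⊆
      ⋃ k ∈ (Finset.range (M + 1)).filter (fun k : ℕ => a < k), {ω | Y ω = k} := by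
    intro ω hω
    simp only [Set.mem_iUnion, Set.mem_ofPred_eq, Finset.mem_filter, Finset.mem_range]
    exact ⟨Y ω, ⟨Nat.lt_succ_of_le (hle ω), hω⟩, rfl⟩
  calc Q {ω | a < Y ω}
      ≤ ∑ k ∈ (Finset.range (M + 1)).filter (fun k : ℕ => a < k), Q {ω | Y ω = k} :=
        (measure_mono hsub).trans (measure_biUnion_finset_le _ _)
    _ = ENNReal.ofReal (∑ k ∈ (Finset.range (M + 1)).filter (fun k : ℕ => a < k),
          (M.choose k : ℝ) * p ^ k * (1 - p) ^ (M - k)) := by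
        rw [ENNReal.ofReal_sum_of_nonneg (fun k _ => by positivity)]
        exact Finset.sum_congr rfl fun k _ => hlaw k
    _ ≤ _ := by
        refine ENNReal.ofReal_le_ofReal ?_
        calc _ ≤ ∑ k ∈ (Finset.range (M + 1)).filter (fun k : ℕ => a < k),
                (M.choose k : ℝ) * p ^ k * (1 - p) ^ (M - k) * Real.exp (s * (k - a)) := by
              refine Finset.sum_le_sum fun k hk => le_mul_of_one_le_right (by positivity) ?_
              exact Real.one_le_exp (mul_nonneg hs (sub_nonneg.2 (Finset.mem_filter.1 hk).2.le))
          _ ≤ ∑ k ∈ Finset.range (M + 1),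
                (M.choose k : ℝ) * p ^ k * (1 - p) ^ (M - k) * Real.exp (s * (k - a)) :=
              Finset.sum_le_sum_of_subset_of_nonneg (Finset.filter_subset _ _)
                fun k _ _ => by positivity
          _ = _ := by
              rw [add_pow, Finset.sum_mul]
              refine Finset.sum_congr rfl fun k _ => ?_
              rw [mul_sub, sub_eq_add_neg (s * (k : ℝ)), Real.exp_add, mul_comm s (k : ℝ), Real.exp_nat_mul,
                mul_pow]
              ring

/-- A Chernoff bound with a deviation that makes the square root of the mean shift by `c / 2`. -/
lemma IsBinomial.measure_lt_div_le_exp (hY : IsBinomial Q Y M p) (hM : 0 < M) (hp0 : 0 ≤ p)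
    (hp1 : p ≤ 1) {α c : ℝ} (hα : 0 < α) (hpα : p ≤ α) (hc : 0 ≤ c) :
    Q {ω | α < (Y ω : ℝ) / M - c ^ 2 / 4 - c * √α} ≤
      ENNReal.ofReal (Real.exp (-(M * (c ^ 2 / 2)))) := by
  have hM' : (0 : ℝ) < M := Nat.cast_pos.2 hM
  have ht : 0 < √α := Real.sqrt_pos.2 hα
  have hsq : √α ^ 2 = α := Real.sq_sqrt hα.le
  set t := √α
  set y := t + c / 2 with hy
  have hty : t ≤ y := by linarith
  have hy0 : 0 < y := ht.trans_le hty
  have hs : 0 ≤ 2 * Real.log (y / t) :=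
    mul_nonneg zero_le_two (Real.log_nonneg ((one_le_div ht).2 hty))
  have hset : {ω | α < (Y ω : ℝ) / M - c ^ 2 / 4 - c * t} = {ω | M * y ^ 2 < (Y ω : ℝ)} := by
    ext ω
    have : M * y ^ 2 < (Y ω : ℝ) ↔ y ^ 2 < (Y ω : ℝ) / M := by rw [lt_div_iff₀' hM']
    have hyt : y ^ 2 = α + c ^ 2 / 4 + c * t := by rw [hy, ← hsq]; ring
    rw [Set.mem_ofPred_eq, Set.mem_ofPred_eq, this, hyt]
    constructor <;> intro h <;> linarith
  rw [hset]
  refine (hY.measure_lt_le_chernoff hp0 hp1 hs _).trans (ENNReal.ofReal_le_ofReal ?_)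
  have hexp : Real.exp (2 * Real.log (y / t)) = y ^ 2 / α := by
    rw [two_mul, Real.exp_add, Real.exp_log (div_pos hy0 ht), ← hsq]
    ring
  have hw : 1 ≤ y ^ 2 / α := hexp ▸ Real.one_le_exp hs
  have hbase : p * (y ^ 2 / α) + (1 - p) ≤ Real.exp (y ^ 2 - t ^ 2) := by
    calc p * (y ^ 2 / α) + (1 - p) = p * (y ^ 2 / α - 1) + 1 := by ring
      _ ≤ α * (y ^ 2 / α - 1) + 1 := by gcongr
      _ = y ^ 2 - t ^ 2 + 1 := by rw [hsq]; field_simp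
      _ ≤ _ := Real.add_one_le_exp _
  have hrate := two_mul_sub_sq_le_poisson_rate ht hty
  calc _ ≤ Real.exp (y ^ 2 - t ^ 2) ^ M * Real.exp (-(2 * Real.log (y / t) * (M * y ^ 2))) := by
        rw [hexp]
        gcongr
    _ = Real.exp (-(M * (2 * y ^ 2 * Real.log (y / t) - y ^ 2 + t ^ 2))) := by
        rw [← Real.exp_nat_mul, ← Real.exp_add]
        ring_nf
    _ ≤ _ := by
        gcongr
        have : y - t = c / 2 := by rw [hy]; ring
        rw [this] at hrate
        linarith

end

/-- Theorem 1, second part: if the true unsafety probability `p` is at most the safety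
threshold `α`, the adaptive Monte-Carlo test falsely declares unsafety with probability
at most `ε`. -/
theorem adaptive_MC_unsafe {Ω : Type*} [MeasurableSpace Ω] (Q : Measure Ω)
    [IsProbabilityMeasure Q] (α ε p : ℝ)
    (hα0 : 0 < α) (hα : α ≤ 1 / 2) (hε : ε ∈ Set.Ioo (0 : ℝ) 1)
    (hp0 : 0 ≤ p) (hp1 : p ≤ 1) (hpα : p ≤ α)
    (M : ℕ → ℕ) (hM : StrictMono M) (hMpos : ∀ r, 1 ≤ r → 0 < M r)
    (Y : ℕ → Ω → ℕ) (hY : ∀ r, 1 ≤ r → IsBinomial Q (Y r) (M r) p)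
    (c : ℕ → ℝ)
    (hc : ∀ r, c r = Real.sqrt ((2 / (M r : ℝ)) * |Real.log (6 * ε / (π ^ 2 * (r : ℝ) ^ 2))|)) :
    Q {ω | ∃ r : ℕ, 1 ≤ r ∧
        α < (Y r ω : ℝ) / (M r : ℝ) - (c r) ^ 2 / 4 - c r * Real.sqrt α}
      ≤ ENNReal.ofReal ε := by
  obtain ⟨hε0, hε1⟩ := hε
  set δ : ℕ → ℝ := fun r => 6 * ε / (π ^ 2 * (r : ℝ) ^ 2) with hδ
  have hδ0 : ∀ r, 0 ≤ δ r := fun r => by positivity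
  have hsum : HasSum δ ε := by
    have hε_eq : 6 * ε / π ^ 2 * (π ^ 2 / 6) = ε := by field_simp
    have hδ_eq : δ = fun r : ℕ => 6 * ε / π ^ 2 * (1 / (r : ℝ) ^ 2) := by
      ext r
      rw [hδ, div_mul_div_comm, mul_one]
    have h := hasSum_zeta_two.mul_left (6 * ε / π ^ 2)
    rw [hε_eq, ← hδ_eq] at h
    exact h
  have hδ1 : ∀ r, 1 ≤ r → δ r ≤ 1 := fun r _ =>
    (le_hasSum hsum r fun j _ => hδ0 j).trans hε1.le
  have hterm : ∀ r : ℕ, Q {ω | 1 ≤ r ∧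
      α < (Y r ω : ℝ) / (M r : ℝ) - (c r) ^ 2 / 4 - c r * Real.sqrt α} ≤
      ENNReal.ofReal (δ r) := by
    intro r
    by_cases hr : 1 ≤ r
    · have hMr : (0 : ℝ) < M r := Nat.cast_pos.2 (hMpos r hr)
      have hδpos : 0 < δ r := by
        have : (0 : ℝ) < r := Nat.cast_pos.2 hr
        positivity
      have hcsq : (M r : ℝ) * (c r ^ 2 / 2) = -Real.log (δ r) := by
        rw [hc r, Real.sq_sqrt (by positivity),
          abs_of_nonpos (Real.log_nonpos hδpos.le (hδ1 r hr))]
        field_simp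
      have h := (hY r hr).measure_lt_div_le_exp (hMpos r hr) hp0 hp1 hα0 hpα
        (hc r ▸ Real.sqrt_nonneg _ : 0 ≤ c r)
      rw [hcsq, neg_neg, Real.exp_log hδpos] at h
      simpa only [hr, true_and] using h
    · simp [hr]
  rw [Set.ofPred_exists]
  calc _ ≤ ∑' r, ENNReal.ofReal (δ r) :=
        (measure_iUnion_le _).trans (ENNReal.tsum_le_tsum hterm)
    _ = ENNReal.ofReal ε := by
        rw [← ENNReal.ofReal_tsum_of_nonneg hδ0 hsum.summable, hsum.tsum_eq]
end

section
/- Let X = (X_1, …, X_n) be a centered Gaussian random vector in ℝ^n (every linear combination of the coordinates is a centered one-dimensional Gaussian), let σ² = max_{1≤i≤n} Var(X_i) with σ > 0, and let m ∈ ℝ be a median of max_{1≤i≤n} X_i, i.e. P(max_i X_i ≤ m) ≥ 1/2 and P(max_i X_i ≥ m) ≥ 1/2. Then for every u ≥ 0, P( max_{1≤i≤n} X_i > u + m ) ≤ 1 − Φ(u/σ), where Φ is the standard normal cumulative distribution function. -/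
open MeasureTheory ProbabilityTheory
open scoped NNReal ENNReal

open Set Filter Topology

/-! ### The standard normal distribution function, its quantile and its isoperimetric profile -/

/-- The standard normal distribution function. -/
noncomputable def normalCDF (x : ℝ) : ℝ := cdf (gaussianReal 0 1) x

/-- The standard normal density. -/
noncomputable def normalPDF (x : ℝ) : ℝ := gaussianPDFReal 0 1 x

/-- The standard normal quantile function, meaningful on `(0, 1)`. -/
noncomputable def normalQuantile (p : ℝ) : ℝ := Function.invFun normalCDF p

/-- The Gaussian isoperimetric profile `φ ∘ Φ⁻¹`, meaningful on `(0, 1)`. -/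
noncomputable def normalProfile (p : ℝ) : ℝ := normalPDF (normalQuantile p)

lemma normalPDF_eq (x : ℝ) :
    normalPDF x = (√(2 * Real.pi))⁻¹ * Real.exp (-x ^ 2 / 2) := by
  simp [normalPDF, gaussianPDFReal]

lemma normalPDF_pos (x : ℝ) : 0 < normalPDF x := gaussianPDFReal_pos _ _ _ one_ne_zero

lemma normalPDF_neg (x : ℝ) : normalPDF (-x) = normalPDF x := by simp [normalPDF_eq]

lemma inv_sqrt_two_pi_le_one : (√(2 * Real.pi))⁻¹ ≤ 1 := by
  apply inv_le_one_of_one_le₀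
  rw [Real.one_le_sqrt]
  linarith [Real.pi_gt_three]

lemma normalPDF_le_of_abs_le {x y : ℝ} (h : |x| ≤ |y|) : normalPDF y ≤ normalPDF x := by
  rw [normalPDF_eq, normalPDF_eq]
  have := sq_le_sq.2 h
  exact mul_le_mul_of_nonneg_left (Real.exp_le_exp.2 (by linarith)) (by positivity)

lemma normalPDF_le_one (x : ℝ) : normalPDF x ≤ 1 := by
  rw [normalPDF_eq]
  refine mul_le_one₀ inv_sqrt_two_pi_le_one (Real.exp_pos _).le (Real.exp_le_one_iff.2 ?_)
  nlinarith [sq_nonneg x]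

lemma hasDerivAt_normalPDF (x : ℝ) : HasDerivAt normalPDF (-(x * normalPDF x)) x := by
  have h : HasDerivAt (fun y : ℝ => (√(2 * Real.pi))⁻¹ * Real.exp (-y ^ 2 / 2))
      ((√(2 * Real.pi))⁻¹ * (Real.exp (-x ^ 2 / 2) * (-(2 * x) / 2))) x := by
    refine (HasDerivAt.exp ?_).const_mul _
    simpa using ((hasDerivAt_pow 2 x).neg).div_const 2
  rw [show normalPDF = _ from funext normalPDF_eq]
  convert! h using 1
  ring

lemma continuous_normalPDF : Continuous normalPDF :=
  continuous_iff_continuousAt.2 fun x => (hasDerivAt_normalPDF x).continuousAt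

lemma abs_mul_normalPDF_le_one (x : ℝ) : |x * normalPDF x| ≤ 1 := by
  rw [abs_mul, abs_of_pos (normalPDF_pos x), normalPDF_eq]
  have h1 : |x| * Real.exp (-x ^ 2 / 2) ≤ 1 := by
    have h2 : |x| ≤ Real.exp (x ^ 2 / 2) := by
      have := Real.add_one_le_exp (x ^ 2 / 2)
      nlinarith [sq_abs x, sq_nonneg (|x| - 1)]
    calc |x| * Real.exp (-x ^ 2 / 2)
        ≤ Real.exp (x ^ 2 / 2) * Real.exp (-x ^ 2 / 2) := by gcongr
      _ = 1 := by rw [← Real.exp_add]; simp [neg_div]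
  calc |x| * ((√(2 * Real.pi))⁻¹ * Real.exp (-x ^ 2 / 2))
      = (√(2 * Real.pi))⁻¹ * (|x| * Real.exp (-x ^ 2 / 2)) := by ring
    _ ≤ 1 := mul_le_one₀ inv_sqrt_two_pi_le_one (by positivity) h1

lemma hasDerivAt_normalCDF (x : ℝ) : HasDerivAt normalCDF (normalPDF x) x := by
  have hInt : Integrable normalPDF := integrable_gaussianPDFReal 0 1
  have heq : ∀ y, normalCDF y =
      (∫ t in Iic (0 : ℝ), normalPDF t) + ∫ t in (0 : ℝ)..y, normalPDF t := by
    intro y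
    rw [← intervalIntegral.integral_Iic_sub_Iic hInt.integrableOn hInt.integrableOn,
      normalCDF, cdf_eq_real, measureReal_def,
      gaussianReal_apply_eq_integral _ one_ne_zero, ENNReal.toReal_ofReal]
    · simp [normalPDF]
    · exact integral_nonneg fun t => (normalPDF_pos t).le
  rw [show normalCDF = _ from funext heq]
  exact (intervalIntegral.integral_hasDerivAt_right
    (continuous_normalPDF.intervalIntegrable _ _)
    (continuous_normalPDF.stronglyMeasurableAtFilter _ _)
    continuous_normalPDF.continuousAt).const_add _

lemma continuous_normalCDF : Continuous normalCDF :=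
  continuous_iff_continuousAt.2 fun x => (hasDerivAt_normalCDF x).continuousAt

lemma strictMono_normalCDF : StrictMono normalCDF :=
  strictMono_of_hasDerivAt_pos hasDerivAt_normalCDF normalPDF_pos

lemma normalCDF_mem (x : ℝ) : normalCDF x ∈ Ioo (0 : ℝ) 1 :=
  ⟨(cdf_nonneg _ (x - 1)).trans_lt (strictMono_normalCDF (by linarith)),
    (strictMono_normalCDF (by linarith : x < x + 1)).trans_le (cdf_le_one _ _)⟩

lemma normalCDF_neg (x : ℝ) : normalCDF (-x) = 1 - normalCDF x := by
  have hd : ∀ y, HasDerivAt (fun z => normalCDF (-z) + normalCDF z) 0 y := by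
    intro y
    have h := ((hasDerivAt_normalCDF (-y)).scomp y (hasDerivAt_neg y)).add (hasDerivAt_normalCDF y)
    convert! h using 1
    simp [normalPDF_neg]
  have hconst : ∀ y, normalCDF (-y) + normalCDF y = normalCDF (-x) + normalCDF x := fun y =>
    is_const_of_deriv_eq_zero (fun z => (hd z).differentiableAt) (fun z => (hd z).deriv) y x
  have hlim : Tendsto (fun z => normalCDF (-z) + normalCDF z) atTop (𝓝 (0 + 1)) :=
    ((tendsto_cdf_atBot _).comp tendsto_neg_atTop_atBot).add (tendsto_cdf_atTop _)
  rw [show (fun z => normalCDF (-z) + normalCDF z) = fun _ => normalCDF (-x) + normalCDF x from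
    funext hconst] at hlim
  linarith [tendsto_nhds_unique hlim tendsto_const_nhds]

lemma normalCDF_zero : normalCDF 0 = 1 / 2 := by
  have := normalCDF_neg 0
  rw [neg_zero] at this
  linarith

lemma normalQuantile_normalCDF (x : ℝ) : normalQuantile (normalCDF x) = x :=
  Function.leftInverse_invFun strictMono_normalCDF.injective x

lemma normalCDF_normalQuantile {p : ℝ} (hp : p ∈ Ioo (0 : ℝ) 1) :
    normalCDF (normalQuantile p) = p := by
  apply Function.invFun_eq
  exact mem_range_of_exists_le_of_exists_ge continuous_normalCDF
    (((tendsto_cdf_atBot (gaussianReal 0 1)).eventually (eventually_le_nhds hp.1)).exists)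
    (((tendsto_cdf_atTop (gaussianReal 0 1)).eventually (eventually_ge_nhds hp.2)).exists)

lemma normalQuantile_le_iff {p q : ℝ} (hp : p ∈ Ioo (0 : ℝ) 1) (hq : q ∈ Ioo (0 : ℝ) 1) :
    normalQuantile p ≤ normalQuantile q ↔ p ≤ q := by
  rw [← strictMono_normalCDF.le_iff_le, normalCDF_normalQuantile hp, normalCDF_normalQuantile hq]

lemma normalQuantile_one_sub {p : ℝ} (hp : p ∈ Ioo (0 : ℝ) 1) :
    normalQuantile (1 - p) = -normalQuantile p := by
  conv_lhs => rw [← normalCDF_normalQuantile hp, ← normalCDF_neg]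
  exact normalQuantile_normalCDF _

lemma continuousAt_normalQuantile {p : ℝ} (hp : p ∈ Ioo (0 : ℝ) 1) :
    ContinuousAt normalQuantile p := by
  refine continuousAt_of_monotoneOn_of_image_mem_nhds (s := Ioo 0 1)
    (fun a ha b hb hab => (normalQuantile_le_iff ha hb).2 hab) (Ioo_mem_nhds hp.1 hp.2) ?_
  rw [show image normalQuantile (Ioo 0 1) = univ from eq_univ_of_forall fun x =>
    ⟨normalCDF x, normalCDF_mem x, normalQuantile_normalCDF x⟩]
  exact univ_mem

lemma hasDerivAt_normalQuantile {p : ℝ} (hp : p ∈ Ioo (0 : ℝ) 1) :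
    HasDerivAt normalQuantile (normalProfile p)⁻¹ p :=
  (hasDerivAt_normalCDF _).of_local_left_inverse (continuousAt_normalQuantile hp)
    (normalPDF_pos _).ne'
    (eventually_of_mem (Ioo_mem_nhds hp.1 hp.2) fun _ hq => normalCDF_normalQuantile hq)

lemma normalProfile_pos (p : ℝ) : 0 < normalProfile p := normalPDF_pos _

lemma normalProfile_one_sub {p : ℝ} (hp : p ∈ Ioo (0 : ℝ) 1) :
    normalProfile (1 - p) = normalProfile p := by
  rw [normalProfile, normalQuantile_one_sub hp, normalPDF_neg, normalProfile]

lemma hasDerivAt_normalProfile {p : ℝ} (hp : p ∈ Ioo (0 : ℝ) 1) :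
    HasDerivAt normalProfile (-normalQuantile p) p := by
  have h := (hasDerivAt_normalPDF (normalQuantile p)).comp p (hasDerivAt_normalQuantile hp)
  convert! h using 1
  rw [← normalProfile]
  field_simp [(normalProfile_pos p).ne']

lemma abs_normalCDF_sub_le (x y : ℝ) :
    |normalCDF y - normalCDF x| ≤ normalPDF x * |y - x| + |y - x| ^ 2 := by
  have hlip : ∀ z, |normalPDF z - normalPDF x| ≤ |z - x| := by
    intro z
    have := convex_univ.norm_image_sub_le_of_norm_hasDerivWithin_le (C := 1)
      (fun w _ => (hasDerivAt_normalPDF w).hasDerivWithinAt)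
      (fun w _ => by rw [norm_neg]; exact abs_mul_normalPDF_le_one w) (mem_univ x) (mem_univ z)
    simpa using this
  have h := (convex_uIcc x y).norm_image_sub_le_of_norm_hasDerivWithin_le
    (C := normalPDF x + |y - x|)
    (fun w _ => (hasDerivAt_normalCDF w).hasDerivWithinAt)
    (fun w hw => by
      have h1 := hlip w
      have h2 := abs_sub_left_of_mem_uIcc hw
      rw [Real.norm_eq_abs, abs_of_pos (normalPDF_pos w)]
      linarith [le_abs_self (normalPDF w - normalPDF x)]) left_mem_uIcc right_mem_uIcc
  calc |normalCDF y - normalCDF x| ≤ (normalPDF x + |y - x|) * |y - x| := h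
    _ = _ := by ring

/-! ### Bobkov's two-point inequality -/

lemma nonneg_of_hasDerivAt_nonneg {f f' : ℝ → ℝ} {b : ℝ} (hf : ∀ x ∈ Ico 0 b, HasDerivAt f (f' x) x)
    (hf' : ∀ x ∈ Ico 0 b, 0 ≤ f' x) (h0 : f 0 = 0) {x : ℝ} (hx : x ∈ Ico 0 b) : 0 ≤ f x := by
  have hsub : ∀ y ∈ Icc 0 x, y ∈ Ico 0 b := fun y hy => ⟨hy.1, hy.2.trans_lt hx.2⟩
  have hmono : MonotoneOn f (Icc 0 x) := by
    refine monotoneOn_of_deriv_nonneg (convex_Icc _ _)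
      (fun y hy => (hf y (hsub y hy)).continuousAt.continuousWithinAt)
      (fun y hy => (hf y (hsub y (interior_subset hy))).differentiableAt.differentiableWithinAt)
      fun y hy => ?_
    rw [(hf y (hsub y (interior_subset hy))).deriv]
    exact hf' y (hsub y (interior_subset hy))
  rw [← h0]
  exact hmono (left_mem_Icc.2 hx.1) (right_mem_Icc.2 hx.1) hx.1

lemma hasDerivAt_normalProfile_sq {p : ℝ} (hp : p ∈ Ioo (0 : ℝ) 1) :
    HasDerivAt (fun q => normalProfile q ^ 2) (-2 * normalProfile p * normalQuantile p) p := by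
  convert! (hasDerivAt_normalProfile hp).pow 2 using 1
  push_cast
  ring

lemma hasDerivAt_normalProfile_mul_normalQuantile {p : ℝ} (hp : p ∈ Ioo (0 : ℝ) 1) :
    HasDerivAt (fun q => normalProfile q * normalQuantile q) (1 - normalQuantile p ^ 2) p := by
  convert! (hasDerivAt_normalProfile hp).mul (hasDerivAt_normalQuantile hp) using 1
  rw [mul_inv_cancel₀ (normalProfile_pos p).ne']
  ring

lemma two_mul_normalQuantile_sq_le {c x : ℝ} (hx : 0 ≤ x) (h0 : 0 < c - x) (h1 : c + x < 1) :
    2 * normalQuantile c ^ 2 ≤ normalQuantile (c + x) ^ 2 + normalQuantile (c - x) ^ 2 := by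
  have hconv : ConvexOn ℝ (Ioo (0 : ℝ) 1) fun p => normalQuantile p ^ 2 := by
    have hd : ∀ p ∈ Ioo (0 : ℝ) 1, HasDerivAt (fun p => normalQuantile p ^ 2)
        (2 * normalQuantile p * (normalProfile p)⁻¹) p := fun p hp => by
      convert! (hasDerivAt_normalQuantile hp).pow 2 using 1
      simp
    have hd2 : ∀ p ∈ Ioo (0 : ℝ) 1,
        HasDerivAt (fun p => 2 * normalQuantile p * (normalProfile p)⁻¹)
          (2 * (1 + normalQuantile p ^ 2) / normalProfile p ^ 2) p := fun p hp => by
      convert! ((hasDerivAt_normalQuantile hp).const_mul 2).mul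
        ((hasDerivAt_normalProfile hp).inv (normalProfile_pos p).ne') using 1
      have := (normalProfile_pos p).ne'
      simp only [Pi.inv_apply]
      field_simp
    refine convexOn_of_hasDerivWithinAt2_nonneg (convex_Ioo _ _)
      (fun p hp => (hd p hp).continuousAt.continuousWithinAt)
      (fun p hp => (hd p (interior_subset hp)).hasDerivWithinAt)
      (fun p hp => (hd2 p (interior_subset hp)).hasDerivWithinAt) fun p _ => by positivity
  have h := hconv.2 (x := c + x) (y := c - x) ⟨by linarith, h1⟩ ⟨h0, by linarith⟩
    (by norm_num : (0 : ℝ) ≤ 1 / 2) (by norm_num : (0 : ℝ) ≤ 1 / 2) (by norm_num)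
  simp only [smul_eq_mul] at h
  rw [show 1 / 2 * (c + x) + 1 / 2 * (c - x) = c by ring] at h
  linarith

lemma abs_normalQuantile_add_le {c x : ℝ} (hc : c ≤ 1 / 2) (hx : 0 ≤ x) (h0 : 0 < c - x) :
    |normalQuantile (c + x)| ≤ |normalQuantile (c - x)| := by
  have hm : c - x ∈ Ioo (0 : ℝ) 1 := ⟨h0, by linarith⟩
  have hp : c + x ∈ Ioo (0 : ℝ) 1 := ⟨by linarith, by linarith⟩
  have hm' : 1 - (c - x) ∈ Ioo (0 : ℝ) 1 := ⟨by linarith [hm.2], by linarith⟩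
  have h1 := (normalQuantile_le_iff hm hp).2 (by linarith)
  have h2 := (normalQuantile_le_iff hp hm').2 (by linarith)
  have h3 := (normalQuantile_le_iff hm hm').2 (by linarith)
  rw [normalQuantile_one_sub hm] at h2 h3
  rw [abs_of_nonpos (a := normalQuantile (c - x)) (by linarith), abs_le]
  exact ⟨by linarith, h2⟩

lemma normalProfile_sq_add_add_sq_sub_ge {c x : ℝ} (hx : 0 ≤ x) (h0 : 0 < c - x) (h1 : c + x < 1) :
    2 * normalQuantile c ^ 2 * x ^ 2 ≤ normalProfile (c + x) ^ 2 + normalProfile (c - x) ^ 2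
      + 2 * x ^ 2 - 2 * normalProfile c ^ 2 := by
  set b := min c (1 - c) with hb
  have hmem : ∀ y ∈ Ico 0 b, c + y ∈ Ioo (0 : ℝ) 1 ∧ c - y ∈ Ioo (0 : ℝ) 1 := fun y hy => by
    have := lt_min_iff.1 hy.2
    have := hy.1
    constructor <;> constructor <;> linarith
  have hxb : x ∈ Ico 0 b := ⟨hx, lt_min (by linarith) (by linarith)⟩
  have hder : ∀ y ∈ Ico 0 b, HasDerivAt
      (fun y => normalProfile (c + y) ^ 2 + normalProfile (c - y) ^ 2 + 2 * y ^ 2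
        - 2 * normalProfile c ^ 2 - 2 * normalQuantile c ^ 2 * y ^ 2)
      (-2 * (normalProfile (c + y) * normalQuantile (c + y))
        + 2 * (normalProfile (c - y) * normalQuantile (c - y)) + 4 * y
        - 4 * normalQuantile c ^ 2 * y) y := fun y hy => by
    have e1 := (hasDerivAt_normalProfile_sq (hmem y hy).1).comp_const_add c y
    have e2 := (hasDerivAt_normalProfile_sq (hmem y hy).2).comp_const_sub c y
    have e3 := (hasDerivAt_pow 2 y).const_mul 2
    have e4 := (hasDerivAt_pow 2 y).const_mul (2 * normalQuantile c ^ 2)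
    convert! (((e1.add e2).add e3).sub_const (2 * normalProfile c ^ 2)).sub e4 using 1
    push_cast
    ring
  have hder2 : ∀ y ∈ Ico 0 b, HasDerivAt
      (fun y => -2 * (normalProfile (c + y) * normalQuantile (c + y))
        + 2 * (normalProfile (c - y) * normalQuantile (c - y)) + 4 * y
        - 4 * normalQuantile c ^ 2 * y)
      (2 * (normalQuantile (c + y) ^ 2 + normalQuantile (c - y) ^ 2
        - 2 * normalQuantile c ^ 2)) y := fun y hy => by
    have e1 := ((hasDerivAt_normalProfile_mul_normalQuantile
      (hmem y hy).1).comp_const_add c y).const_mul (-2)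
    have e2 := ((hasDerivAt_normalProfile_mul_normalQuantile
      (hmem y hy).2).comp_const_sub c y).const_mul 2
    convert! ((e1.add e2).add ((hasDerivAt_id y).const_mul 4)).sub
      ((hasDerivAt_id y).const_mul (4 * normalQuantile c ^ 2)) using 1
    ring
  have := nonneg_of_hasDerivAt_nonneg hder (fun y hy => nonneg_of_hasDerivAt_nonneg hder2
    (fun z hz => by
      have := two_mul_normalQuantile_sq_le hz.1 (hmem z hz).2.1 (hmem z hz).1.2
      linarith) (by simp) hy) (by simp; ring) hxb
  linarith

lemma normalProfile_sq_add_sub_sq_sub_le {c x : ℝ} (hc : c ≤ 1 / 2) (hx : 0 ≤ x) (h0 : 0 < c - x) :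
    normalProfile (c + x) ^ 2 - normalProfile (c - x) ^ 2
      ≤ -4 * x * normalProfile c * normalQuantile c := by
  have hmem : ∀ y ∈ Ico 0 c, c + y ∈ Ioo (0 : ℝ) 1 ∧ c - y ∈ Ioo (0 : ℝ) 1 := fun y hy => by
    have := hy.1
    have := hy.2
    constructor <;> constructor <;> linarith
  have hxb : x ∈ Ico 0 c := ⟨hx, by linarith⟩
  have hder : ∀ y ∈ Ico 0 c, HasDerivAt
      (fun y => -4 * normalProfile c * normalQuantile c * y - normalProfile (c + y) ^ 2
        + normalProfile (c - y) ^ 2)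
      (-4 * normalProfile c * normalQuantile c
        + 2 * (normalProfile (c + y) * normalQuantile (c + y))
        + 2 * (normalProfile (c - y) * normalQuantile (c - y))) y := fun y hy => by
    have e1 := (hasDerivAt_normalProfile_sq (hmem y hy).1).comp_const_add c y
    have e2 := (hasDerivAt_normalProfile_sq (hmem y hy).2).comp_const_sub c y
    convert! (((hasDerivAt_id y).const_mul
      (-4 * normalProfile c * normalQuantile c)).sub e1).add e2 using 1
    ring
  have hder2 : ∀ y ∈ Ico 0 c, HasDerivAt
      (fun y => -4 * normalProfile c * normalQuantile c
        + 2 * (normalProfile (c + y) * normalQuantile (c + y))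
        + 2 * (normalProfile (c - y) * normalQuantile (c - y)))
      (2 * (normalQuantile (c - y) ^ 2 - normalQuantile (c + y) ^ 2)) y := fun y hy => by
    have e1 := ((hasDerivAt_normalProfile_mul_normalQuantile
      (hmem y hy).1).comp_const_add c y).const_mul 2
    have e2 := ((hasDerivAt_normalProfile_mul_normalQuantile
      (hmem y hy).2).comp_const_sub c y).const_mul 2
    convert! (e1.const_add (-4 * normalProfile c * normalQuantile c)).add e2 using 1
    ring
  have := nonneg_of_hasDerivAt_nonneg hder (fun y hy => nonneg_of_hasDerivAt_nonneg hder2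
    (fun z hz => by
      have := sq_le_sq.2 (abs_normalQuantile_add_le hc hz.1 (hmem z hz).2.1)
      linarith) (by simp; ring) hy) (by simp) hxb
  linarith

lemma normalProfile_two_point_of_le_half {c x : ℝ} (hc : c ≤ 1 / 2) (hx : 0 ≤ x) (h0 : 0 < c - x) :
    2 * normalProfile c ≤ √(normalProfile (c + x) ^ 2 + x ^ 2)
      + √(normalProfile (c - x) ^ 2 + x ^ 2) := by
  have h1 := normalProfile_sq_add_add_sq_sub_ge hx h0 (by linarith)
  have h2 := normalProfile_sq_add_sub_sq_sub_le hc hx h0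
  have h3 : normalProfile (c - x) ^ 2 ≤ normalProfile (c + x) ^ 2 :=
    pow_le_pow_left₀ (normalProfile_pos _).le
      (normalPDF_le_of_abs_le (abs_normalQuantile_add_le hc hx h0)) 2
  have hi := normalProfile_pos c
  have hA : 0 ≤ normalProfile (c + x) ^ 2 + x ^ 2 := by positivity
  have hB : 0 ≤ normalProfile (c - x) ^ 2 + x ^ 2 := by positivity
  generalize normalProfile (c + x) ^ 2 = A at *
  generalize normalProfile (c - x) ^ 2 = B at *
  generalize normalProfile c = i at *
  generalize normalQuantile c = t at *
  have h4 : (A - B) ^ 2 ≤ 16 * x ^ 2 * i ^ 2 * t ^ 2 :=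
    (pow_le_pow_left₀ (by linarith) h2 2).trans_eq (by ring)
  have h5 : i ^ 2 * (2 * t ^ 2 * x ^ 2) ≤ i ^ 2 * (A + B + 2 * x ^ 2 - 2 * i ^ 2) := by gcongr
  have h6 : (2 * i ^ 2 - (A + B + 2 * x ^ 2) / 2) ≤ √(A + x ^ 2) * √(B + x ^ 2) := by
    rw [← Real.sqrt_mul hA]
    apply Real.le_sqrt_of_sq_le
    nlinarith
  have h7 := Real.sq_sqrt hA
  have h8 := Real.sq_sqrt hB
  refine abs_le_of_sq_le_sq' ?_ (by positivity) |>.2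
  nlinarith

/-- **Bobkov's two-point inequality**. -/
lemma normalProfile_two_point {a b : ℝ} (ha : a ∈ Ioo (0 : ℝ) 1) (hb : b ∈ Ioo (0 : ℝ) 1) :
    normalProfile ((a + b) / 2) ≤ (√(normalProfile a ^ 2 + ((a - b) / 2) ^ 2)
      + √(normalProfile b ^ 2 + ((a - b) / 2) ^ 2)) / 2 := by
  wlog hab : b ≤ a generalizing a b
  · have := this hb ha (le_of_not_ge hab)
    rw [add_comm b a, ← neg_sub a b, neg_div, neg_sq] at this
    linarith
  wlog hc : (a + b) / 2 ≤ 1 / 2 generalizing a b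
  · have ha' : 1 - a ∈ Ioo (0 : ℝ) 1 := ⟨by linarith [ha.2], by linarith [ha.1]⟩
    have hb' : 1 - b ∈ Ioo (0 : ℝ) 1 := ⟨by linarith [hb.2], by linarith [hb.1]⟩
    have := this hb' ha' (by linarith) (by linarith)
    rw [normalProfile_one_sub ha, normalProfile_one_sub hb,
      show (1 - b + (1 - a)) / 2 = 1 - (a + b) / 2 by ring,
      normalProfile_one_sub ⟨by linarith [ha.1, hb.1], by linarith [ha.2, hb.2]⟩,
      show 1 - b - (1 - a) = a - b by ring] at this
    linarith
  have := normalProfile_two_point_of_le_half (c := (a + b) / 2) (x := (a - b) / 2) hc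
    (by linarith) (by linarith [hb.1])
  rw [show (a + b) / 2 + (a - b) / 2 = a by ring,
    show (a + b) / 2 - (a - b) / 2 = b by ring] at this
  linarith

/-! ### Rademacher sums and Bobkov's inequality on the discrete cube -/

/-- The law of `x + ∑ₖ εₖ hₖ` where the `hₖ` are the entries of the list and the `εₖ` are
independent uniform random signs. -/
noncomputable def rademacherSum {E : Type*} [AddCommGroup E] [MeasurableSpace E] :
    List E → E → Measure E
  | [], x => Measure.dirac x
  | h :: hs, x =>
    (1 / 2 : ℝ≥0) • rademacherSum hs (x + h) + (1 / 2 : ℝ≥0) • rademacherSum hs (x - h)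

section RademacherSum

variable {E : Type*} [AddCommGroup E] [MeasurableSpace E]

instance isProbabilityMeasure_rademacherSum (hs : List E) (x : E) :
    IsProbabilityMeasure (rademacherSum hs x) := by
  induction hs generalizing x with
  | nil => exact Measure.dirac.isProbabilityMeasure
  | cons h hs ih =>
    refine ⟨?_⟩
    simp only [rademacherSum, Measure.coe_add, Pi.add_apply, Measure.smul_apply, measure_univ]
    rw [← add_smul, add_halves, one_smul]

variable [MeasurableSingletonClass E] {F : Type*} [NormedAddCommGroup F]

lemma integrable_rademacherSum (hs : List E) (x : E) (f : E → F) :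
    Integrable f (rademacherSum hs x) := by
  induction hs generalizing x with
  | nil => exact integrable_dirac (by simp)
  | cons h hs ih => exact (ih _).smul_measure_nnreal.add_measure (ih _).smul_measure_nnreal

variable [NormedSpace ℝ F]

lemma integral_rademacherSum_cons [CompleteSpace F] (h : E) (hs : List E) (x : E) (f : E → F) :
    ∫ y, f y ∂rademacherSum (h :: hs) x =
      (1 / 2 : ℝ) • ((∫ y, f y ∂rademacherSum hs (x + h)) + ∫ y, f y ∂rademacherSum hs (x - h)) := by
  rw [rademacherSum, integral_add_measure
    (integrable_rademacherSum _ _ f).smul_measure_nnreal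
    (integrable_rademacherSum _ _ f).smul_measure_nnreal,
    integral_smul_nnreal_measure, integral_smul_nnreal_measure, smul_add]
  simp [NNReal.smul_def]

lemma integral_rademacherSum_add [CompleteSpace F] (hs : List E) (x v : E) (f : E → F) :
    ∫ y, f y ∂rademacherSum hs (x + v) = ∫ y, f (y + v) ∂rademacherSum hs x := by
  induction hs generalizing x with
  | nil => simp [rademacherSum]
  | cons h hs ih =>
    rw [integral_rademacherSum_cons, integral_rademacherSum_cons, ← ih, ← ih,
      add_right_comm, add_sub_right_comm]

end RademacherSum

lemma sqrt_integral_sq_add_integral_sq_le {α : Type*} [MeasurableSpace α] {μ : Measure α}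
    {u v : α → ℝ} (hu : Integrable u μ) (hv : Integrable v μ) :
    √((∫ y, u y ∂μ) ^ 2 + (∫ y, v y ∂μ) ^ 2) ≤ ∫ y, √(u y ^ 2 + v y ^ 2) ∂μ := by
  have hnorm : ∀ a b : ℝ, ‖(a : ℂ) + b * Complex.I‖ = √(a ^ 2 + b ^ 2) := fun a b =>
    Complex.norm_add_mul_I a b
  have h := norm_integral_le_integral_norm (μ := μ) fun y => (u y : ℂ) + v y * Complex.I
  rw [integral_add hu.ofReal (hv.ofReal.mul_const _), integral_mul_const] at h
  simpa only [integral_complex_ofReal, hnorm] using! h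

lemma integral_rademacherSum_mem_Ioo {E : Type*} [AddCommGroup E] [MeasurableSpace E]
    [MeasurableSingletonClass E] {f : E → ℝ} (hf : ∀ y, f y ∈ Ioo (0 : ℝ) 1) (hs : List E) (x : E) :
    ∫ y, f y ∂rademacherSum hs x ∈ Ioo (0 : ℝ) 1 := by
  induction hs generalizing x with
  | nil => simpa [rademacherSum] using! hf x
  | cons h hs ih =>
    rw [integral_rademacherSum_cons, smul_eq_mul]
    have h1 := ih (x + h)
    have h2 := ih (x - h)
    exact ⟨by linarith [h1.1, h2.1], by linarith [h1.2, h2.2]⟩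

/-- **Bobkov's inequality on the discrete cube**: `D h y` bounds the squared discrete derivative
of `f` at `y` along the step `h`. -/
lemma normalProfile_integral_rademacherSum_le {E : Type*} [AddCommGroup E] [MeasurableSpace E]
    [MeasurableSingletonClass E] {f : E → ℝ} (hf : ∀ y, f y ∈ Ioo (0 : ℝ) 1) {D : E → E → ℝ}
    (hs : List E)
    (hD : ∀ h ∈ hs, ∀ y, ((f y - f (y - (2 : ℕ) • h)) / 2) ^ 2 ≤ D h y)
    (hD' : ∀ h ∈ hs, ∀ y, ((f y - f (y + (2 : ℕ) • h)) / 2) ^ 2 ≤ D h y) (x : E) :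
    normalProfile (∫ y, f y ∂rademacherSum hs x) ≤
      ∫ y, √(normalProfile (f y) ^ 2 + (hs.map fun h => D h y).sum) ∂rademacherSum hs x := by
  induction hs generalizing x with
  | nil => simp [rademacherSum, Real.sqrt_sq (normalProfile_pos _).le]
  | cons h hs ih =>
    specialize ih (fun k hk => hD k (List.mem_cons_of_mem _ hk))
      fun k hk => hD' k (List.mem_cons_of_mem _ hk)
    have hInt : ∀ (g : E → ℝ) z, Integrable g (rademacherSum hs z) :=
      fun g z => integrable_rademacherSum hs z g
    have hsum : ∀ y, 0 ≤ (hs.map fun h => D h y).sum := fun y =>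
      List.sum_nonneg fun d hd => by
        obtain ⟨k, hk, rfl⟩ := List.mem_map.1 hd
        exact (sq_nonneg _).trans (hD k (List.mem_cons_of_mem _ hk) y)
    have key : ∀ (z v : E), (∀ y, ((f y - f (y + v)) / 2) ^ 2 ≤ D h y) →
        √(normalProfile (∫ y, f y ∂rademacherSum hs z) ^ 2
          + (((∫ y, f y ∂rademacherSum hs z) - ∫ y, f y ∂rademacherSum hs (z + v)) / 2) ^ 2) ≤
        ∫ y, √(normalProfile (f y) ^ 2 + ((h :: hs).map fun h => D h y).sum)
          ∂rademacherSum hs z := by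
      intro z v hv
      rw [integral_rademacherSum_add, ← integral_sub (hInt _ _) (hInt _ _), ← integral_div]
      calc _ ≤ √((∫ y, √(normalProfile (f y) ^ 2 + (hs.map fun h => D h y).sum)
              ∂rademacherSum hs z) ^ 2
            + (∫ y, (f y - f (y + v)) / 2 ∂rademacherSum hs z) ^ 2) := by
            apply Real.sqrt_le_sqrt
            gcongr
            · exact (normalProfile_pos _).le
            · exact ih z
        _ ≤ _ := sqrt_integral_sq_add_integral_sq_le (hInt _ _) (hInt _ _)
        _ ≤ _ := by
            refine integral_mono (hInt _ _) (hInt _ _) fun y => Real.sqrt_le_sqrt ?_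
            rw [Real.sq_sqrt (add_nonneg (sq_nonneg _) (hsum y)), List.map_cons, List.sum_cons]
            linarith [hv y]
    rw [integral_rademacherSum_cons, integral_rademacherSum_cons, smul_eq_mul, smul_eq_mul]
    have hp := key (x + h) (-((2 : ℕ) • h)) fun y => by
      rw [← sub_eq_add_neg]
      exact hD h List.mem_cons_self y
    have hm := key (x - h) ((2 : ℕ) • h) (hD' h List.mem_cons_self)
    rw [show x + h + -((2 : ℕ) • h) = x - h by abel] at hp
    rw [show x - h + (2 : ℕ) • h = x + h by abel] at hm
    have h2 := normalProfile_two_point (integral_rademacherSum_mem_Ioo hf hs (x + h))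
      (integral_rademacherSum_mem_Ioo hf hs (x - h))
    rw [show ∀ a b : ℝ, ((a - b) / 2) ^ 2 = ((b - a) / 2) ^ 2 from fun a b => by ring] at hm
    rw [one_div_mul_eq_div, one_div_mul_eq_div]
    refine h2.trans ?_
    gcongr

/-! ### The soft maximum -/

section SoftMax

variable {ι : Type*} [Fintype ι]

/-- The smooth approximation `β⁻¹ log ∑ᵢ exp (β xᵢ)` of the maximum. -/
noncomputable def softMax (β : ℝ) (x : ι → ℝ) : ℝ := β⁻¹ * Real.log (∑ i, Real.exp (β * x i))

/-- The weights of the gradient of the soft maximum. -/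
noncomputable def softMaxWeight (β : ℝ) (x : ι → ℝ) (i : ι) : ℝ :=
  Real.exp (β * x i) / ∑ j, Real.exp (β * x j)

lemma sum_softMaxWeight_mul_exp (β : ℝ) (x h : ι → ℝ) :
    ∑ i, softMaxWeight β x i * Real.exp (β * h i) =
      (∑ i, Real.exp (β * (x + h) i)) / ∑ i, Real.exp (β * x i) := by
  rw [Finset.sum_div]
  refine Finset.sum_congr rfl fun i _ => ?_
  rw [softMaxWeight, Pi.add_apply, mul_add, Real.exp_add]
  ring

variable [Nonempty ι]

lemma sum_exp_pos (β : ℝ) (x : ι → ℝ) : 0 < ∑ i, Real.exp (β * x i) :=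
  Finset.sum_pos (fun _ _ => Real.exp_pos _) Finset.univ_nonempty

lemma continuous_softMax (β : ℝ) : Continuous (softMax β : (ι → ℝ) → ℝ) :=
  continuous_const.mul (Continuous.log (by fun_prop) fun x => (sum_exp_pos β x).ne')

lemma softMaxWeight_pos (β : ℝ) (x : ι → ℝ) (i : ι) : 0 < softMaxWeight β x i :=
  div_pos (Real.exp_pos _) (sum_exp_pos β x)

lemma sum_softMaxWeight (β : ℝ) (x : ι → ℝ) : ∑ i, softMaxWeight β x i = 1 := by
  simp_rw [softMaxWeight, ← Finset.sum_div]
  exact div_self (sum_exp_pos β x).ne'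

lemma le_softMax {β : ℝ} (hβ : 0 < β) (x : ι → ℝ) (i : ι) : x i ≤ softMax β x := by
  rw [softMax, le_inv_mul_iff₀ hβ, Real.le_log_iff_exp_le (sum_exp_pos β x)]
  exact Finset.single_le_sum (f := fun i => Real.exp (β * x i)) (fun _ _ => (Real.exp_pos _).le)
    (Finset.mem_univ i)

lemma softMax_le {β : ℝ} (hβ : 0 < β) {x : ι → ℝ} {M : ℝ} (hM : ∀ i, x i ≤ M) :
    softMax β x ≤ M + β⁻¹ * Real.log (Fintype.card ι) := by
  have h : Real.log (∑ i, Real.exp (β * x i)) ≤ Real.log (Fintype.card ι * Real.exp (β * M)) := by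
    apply Real.log_le_log (sum_exp_pos β x)
    rw [← nsmul_eq_mul]
    exact Finset.sum_le_card_nsmul _ _ _ fun i _ => Real.exp_le_exp.2 (by gcongr; exact hM i)
  rw [Real.log_mul (by simp) (Real.exp_pos _).ne', Real.log_exp] at h
  calc softMax β x ≤ β⁻¹ * (Real.log (Fintype.card ι) + β * M) := by
        rw [softMax]
        gcongr
    _ = _ := by field_simp; ring

lemma abs_softMax_add_sub_sub_le {β H : ℝ} (hβ : 0 < β) (x : ι → ℝ) {h : ι → ℝ}
    (hh : ∀ i, |h i| ≤ H) (hβH : β * H ≤ 1) :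
    |softMax β (x + h) - softMax β x - ∑ i, softMaxWeight β x i * h i| ≤ β * H ^ 2 := by
  set s := ∑ i, softMaxWeight β x i * h i with hs
  set A := ∑ i, softMaxWeight β x i * Real.exp (β * h i) with hA
  have hA0 : 0 < A := Finset.sum_pos
    (fun i _ => mul_pos (softMaxWeight_pos β x i) (Real.exp_pos _)) Finset.univ_nonempty
  have hdiff : softMax β (x + h) - softMax β x = β⁻¹ * Real.log A := by
    rw [hA, sum_softMaxWeight_mul_exp, Real.log_div (sum_exp_pos _ _).ne' (sum_exp_pos _ _).ne',
      softMax, softMax]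
    ring
  have hsum : ∀ a b : ℝ, ∑ i, softMaxWeight β x i * (a + b * h i) = a + b * s := by
    intro a b
    simp_rw [mul_add, Finset.sum_add_distrib, ← Finset.sum_mul, sum_softMaxWeight, one_mul, hs,
      Finset.mul_sum]
    congr 1
    exact Finset.sum_congr rfl fun i _ => by ring
  have hlow : β * s ≤ Real.log A := by
    rw [Real.le_log_iff_exp_le hA0]
    calc Real.exp (β * s)
        = ∑ i, softMaxWeight β x i * (Real.exp (β * s) * (1 - β * s)
            + Real.exp (β * s) * β * h i) := by rw [hsum]; ring
      _ ≤ A := by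
        refine Finset.sum_le_sum fun i _ =>
          mul_le_mul_of_nonneg_left ?_ (softMaxWeight_pos β x i).le
        have h1 := Real.add_one_le_exp (β * h i - β * s)
        calc _ = Real.exp (β * s) * (β * h i - β * s + 1) := by ring
          _ ≤ Real.exp (β * s) * Real.exp (β * h i - β * s) := by gcongr
          _ = _ := by rw [← Real.exp_add]; ring_nf
  have hup : Real.log A ≤ β * s + (β * H) ^ 2 := by
    have h1 : A ≤ 1 + (β * H) ^ 2 + β * s := by
      rw [← hsum]
      refine Finset.sum_le_sum fun i _ =>
        mul_le_mul_of_nonneg_left ?_ (softMaxWeight_pos β x i).le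
      have h2 : |β * h i| ≤ β * H := by
        rw [abs_mul, abs_of_pos hβ]
        exact mul_le_mul_of_nonneg_left (hh i) hβ.le
      have h3 := Real.abs_exp_sub_one_sub_id_le (h2.trans hβH)
      have h4 := sq_le_sq' (abs_le.1 h2).1 (abs_le.1 h2).2
      linarith [le_abs_self (Real.exp (β * h i) - 1 - β * h i)]
    linarith [Real.log_le_sub_one_of_pos hA0]
  rw [hdiff, show β⁻¹ * Real.log A - s = β⁻¹ * (Real.log A - β * s) by field_simp,
    abs_of_nonneg (by have := sub_nonneg.2 hlow; positivity), inv_mul_le_iff₀ hβ]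
  linarith

lemma normalCDF_softMax_diff_sq_le {β η H r : ℝ} (hβ : 0 < β) (hη : 0 < η) (x : ι → ℝ)
    {k : ι → ℝ} (hk : ∀ i, |k i| ≤ 2 * H) (hβH : 2 * β * H ≤ 1) (hH : H ≤ 1) :
    ((normalCDF ((r - softMax β x) / η) - normalCDF ((r - softMax β (x + k)) / η)) / 2) ^ 2 ≤
      (normalPDF ((r - softMax β x) / η) / η) ^ 2 * ((∑ i, softMaxWeight β x i * k i) / 2) ^ 2
        + (2 * (2 * β / η + 8 / η ^ 2) / η + (2 * β / η + 8 / η ^ 2) ^ 2) * H ^ 3 := by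
  obtain ⟨i₀⟩ := ‹Nonempty ι›
  have hH0 : 0 ≤ H := by linarith [abs_nonneg (k i₀), hk i₀]
  set s := (∑ i, softMaxWeight β x i * k i) / 2 with hs
  set u := (r - softMax β x) / η with hu
  set w := (r - softMax β (x + k)) / η with hw
  set κ := 2 * β / η + 8 / η ^ 2 with hκ
  have hκ0 : 0 < κ := by positivity
  have hsH : |s| ≤ H := by
    rw [hs, abs_div, abs_two, div_le_iff₀ two_pos]
    calc |∑ i, softMaxWeight β x i * k i| ≤ ∑ i, softMaxWeight β x i * (H * 2) := by
          refine (Finset.abs_sum_le_sum_abs _ _).trans (Finset.sum_le_sum fun i _ => ?_)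
          rw [abs_mul, abs_of_pos (softMaxWeight_pos β x i), mul_comm H]
          exact mul_le_mul_of_nonneg_left (hk i) (softMaxWeight_pos β x i).le
      _ = H * 2 := by rw [← Finset.sum_mul, sum_softMaxWeight, one_mul]
  have hwu : |w - u| ≤ (2 * |s| + 4 * β * H ^ 2) / η := by
    have h1 := abs_softMax_add_sub_sub_le hβ x hk (by linarith)
    have h2 : w - u = -((softMax β (x + k) - softMax β x) / η) := by rw [hw, hu]; ring
    rw [h2, abs_neg, abs_div, abs_of_pos hη]
    gcongr
    have h3 := abs_add_le (softMax β (x + k) - softMax β x - ∑ i, softMaxWeight β x i * k i)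
      (∑ i, softMaxWeight β x i * k i)
    rw [sub_add_cancel, show ∑ i, softMaxWeight β x i * k i = 2 * s by rw [hs]; ring, abs_mul,
      abs_two] at h3
    rw [show ∑ i, softMaxWeight β x i * k i = 2 * s by rw [hs]; ring] at h1
    linarith
  have hwu' : |w - u| ≤ 4 * H / η := by
    refine hwu.trans ?_
    gcongr
    nlinarith
  have hφ := normalPDF_le_one u
  have hφ0 := normalPDF_pos u
  have hmain : |(normalCDF u - normalCDF w) / 2| ≤ normalPDF u / η * |s| + κ * H ^ 2 := by
    have h1 := abs_normalCDF_sub_le u w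
    rw [abs_div, abs_two, abs_sub_comm, div_le_iff₀ two_pos]
    calc |normalCDF w - normalCDF u|
        ≤ normalPDF u * |w - u| + |w - u| ^ 2 := h1
      _ ≤ normalPDF u * ((2 * |s| + 4 * β * H ^ 2) / η) + (4 * H / η) ^ 2 := by gcongr
      _ = normalPDF u / η * |s| * 2 + normalPDF u * (4 * β * H ^ 2 / η) + 16 * H ^ 2 / η ^ 2 := by
          ring
      _ ≤ normalPDF u / η * |s| * 2 + 1 * (4 * β * H ^ 2 / η) + 16 * H ^ 2 / η ^ 2 := by gcongr
      _ = _ := by rw [hκ]; ring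
  calc ((normalCDF u - normalCDF w) / 2) ^ 2
      ≤ (normalPDF u / η * |s| + κ * H ^ 2) ^ 2 := by
        rw [← sq_abs]
        gcongr
    _ = (normalPDF u / η) ^ 2 * |s| ^ 2
        + (2 * κ / η * (normalPDF u * |s| * H ^ 2) + κ ^ 2 * (H ^ 3 * H)) := by ring
    _ ≤ (normalPDF u / η) ^ 2 * |s| ^ 2
        + (2 * κ / η * (1 * H * H ^ 2) + κ ^ 2 * (H ^ 3 * 1)) := by gcongr
    _ = _ := by rw [sq_abs]; ring

end SoftMax

/-! ### Central limit theorem for Rademacher sums -/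

lemma charFun_rademacherSum {E : Type*} [NormedAddCommGroup E] [InnerProductSpace ℝ E]
    [MeasurableSpace E] [MeasurableSingletonClass E] (hs : List E) (x t : E) :
    charFun (rademacherSum hs x) t =
      Complex.exp (inner ℝ x t * Complex.I) *
        (hs.map fun h => (Real.cos (inner ℝ h t) : ℂ)).prod := by
  simp only [charFun_apply]
  induction hs generalizing x with
  | nil => simp [rademacherSum]
  | cons h hs ih =>
    rw [integral_rademacherSum_cons, ih, ih, inner_add_left, inner_sub_left, List.map_cons,
      List.prod_cons, Complex.ofReal_cos, Complex.cos]
    push_cast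
    rw [add_mul, sub_mul, Complex.exp_add, sub_eq_add_neg, Complex.exp_add, neg_mul,
      Complex.real_smul]
    push_cast
    ring

lemma tendsto_cos_inv_sqrt_mul_pow (s : ℝ) :
    Tendsto (fun N : ℕ => (Real.cos ((√N)⁻¹ * s) : ℂ) ^ N) atTop
      (𝓝 (Complex.exp (-s ^ 2 / 2))) := by
  have h := tendsto_charFun_inv_sqrt_mul_pow (P := rademacherSum [(1 : ℝ)] 0) (X := id)
    aemeasurable_id (by rw [integral_rademacherSum_cons]; simp [rademacherSum])
    (by rw [integral_rademacherSum_cons]; simp [rademacherSum]; norm_num) s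
  simpa [Measure.map_id, charFun_rademacherSum] using h

lemma prod_map_flatMap_replicate {κ E M : Type*} [CommMonoid M] (l : List κ) (N : ℕ) (v : κ → E)
    (g : E → M) :
    ((l.flatMap fun j => List.replicate N (v j)).map g).prod =
      (l.map fun j => g (v j) ^ N).prod := by
  induction l with
  | nil => simp
  | cons a l ih => simp [ih]

lemma sum_map_flatMap_replicate {κ E : Type*} (l : List κ) (N : ℕ) (v : κ → E) (g : E → ℝ) :
    ((l.flatMap fun j => List.replicate N (v j)).map g).sum = (l.map fun j => N * g (v j)).sum := by
  induction l with
  | nil => simp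
  | cons a l ih => simp [ih]

section CentralLimit

variable {κ E : Type*} [Fintype κ] [NormedAddCommGroup E] [InnerProductSpace ℝ E]

/-- The list consisting of `N` copies of each of the vectors `bⱼ / √N`. -/
noncomputable def cltSteps (b : κ → E) (N : ℕ) : List E :=
  (Finset.univ : Finset κ).toList.flatMap fun j => List.replicate N ((√(N : ℝ))⁻¹ • b j)

lemma sum_map_cltSteps (b : κ → E) (N : ℕ) (g : E → ℝ) :
    ((cltSteps b N).map g).sum = ∑ j, N * g ((√(N : ℝ))⁻¹ • b j) := by
  rw [cltSteps, sum_map_flatMap_replicate, Finset.sum_map_toList]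

lemma prod_map_cltSteps {M : Type*} [CommMonoid M] (b : κ → E) (N : ℕ) (g : E → M) :
    ((cltSteps b N).map g).prod = ∏ j, g ((√(N : ℝ))⁻¹ • b j) ^ N := by
  rw [cltSteps, prod_map_flatMap_replicate, Finset.prod_map_toList]

lemma exists_of_mem_cltSteps {b : κ → E} {N : ℕ} {h : E} (hh : h ∈ cltSteps b N) :
    ∃ j, h = (√(N : ℝ))⁻¹ • b j := by
  obtain ⟨j, -, hj⟩ := List.mem_flatMap.1 hh
  exact ⟨j, List.eq_of_mem_replicate hj⟩

/-- A multivariate **central limit theorem** for Rademacher sums. -/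
lemma tendsto_integral_rademacherSum_cltSteps [FiniteDimensional ℝ E] [MeasurableSpace E]
    [BorelSpace E] (b : κ → E) {ν : Measure E} [IsProbabilityMeasure ν]
    (hν : ∀ t, charFun ν t = Complex.exp (-((∑ j, inner ℝ (b j) t ^ 2 : ℝ) : ℂ) / 2))
    (f : BoundedContinuousFunction E ℝ) :
    Tendsto (fun N => ∫ y, f y ∂rademacherSum (cltSteps b N) 0) atTop (𝓝 (∫ y, f y ∂ν)) := by
  let μ : ℕ → ProbabilityMeasure E := fun N =>
    ⟨rademacherSum (cltSteps b N) 0, isProbabilityMeasure_rademacherSum _ _⟩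
  let ν' : ProbabilityMeasure E := ⟨ν, inferInstance⟩
  suffices h : Tendsto μ atTop (𝓝 ν') from
    ProbabilityMeasure.tendsto_iff_forall_integral_tendsto.1 h f
  refine ProbabilityMeasure.tendsto_iff_tendsto_charFun.2 fun t => ?_
  have h := tendsto_finsetProd Finset.univ fun j _ => tendsto_cos_inv_sqrt_mul_pow (inner ℝ (b j) t)
  rw [← Complex.exp_sum] at h
  have e : charFun (ν' : Measure E) t = Complex.exp (∑ j, -(inner ℝ (b j) t : ℂ) ^ 2 / 2) := by
    change charFun ν t = _
    rw [hν]
    push_cast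
    rw [← Finset.sum_neg_distrib, Finset.sum_div]
  rw [e]
  convert! h using 2 with N
  change charFun (rademacherSum _ _) t = _
  rw [charFun_rademacherSum, prod_map_cltSteps]
  simp [inner_smul_left]

end CentralLimit

/-! ### Bobkov's inequality for the Gaussian measure -/

lemma normalProfile_integral_softMax_le {κ ι : Type*} [Fintype κ] [Fintype ι] [Nonempty ι]
    {b : κ → EuclideanSpace ℝ ι} {ν : Measure (EuclideanSpace ℝ ι)} [IsProbabilityMeasure ν]
    (hν : ∀ t, charFun ν t = Complex.exp (-((∑ j, inner ℝ (b j) t ^ 2 : ℝ) : ℂ) / 2))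
    {σ β η : ℝ} (hσ : 0 < σ) (hb : ∀ i, ∑ j, b j i ^ 2 ≤ σ ^ 2) (hβ : 0 < β) (hη : 0 < η) (r : ℝ)
    (hmem : ∫ y, normalCDF ((r - softMax β y.ofLp) / η) ∂ν ∈ Ioo (0 : ℝ) 1) :
    normalProfile (∫ y, normalCDF ((r - softMax β y.ofLp) / η) ∂ν) ≤
      √(1 + σ ^ 2 / η ^ 2) * ∫ y, normalPDF ((r - softMax β y.ofLp) / η) ∂ν := by
  set u : EuclideanSpace ℝ ι → ℝ := fun y => (r - softMax β y.ofLp) / η with hu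
  have hcont : Continuous u :=
    (continuous_const.sub ((continuous_softMax β).comp (PiLp.continuous_ofLp 2 _))).div_const η
  let f : BoundedContinuousFunction (EuclideanSpace ℝ ι) ℝ :=
    .ofNormedAddCommGroup (fun y => normalCDF (u y)) (continuous_normalCDF.comp hcont) 1 fun y => by
      rw [Real.norm_eq_abs, abs_of_pos (normalCDF_mem _).1]
      exact (normalCDF_mem _).2.le
  let g : BoundedContinuousFunction (EuclideanSpace ℝ ι) ℝ :=
    .ofNormedAddCommGroup (fun y => normalPDF (u y)) (continuous_normalPDF.comp hcont) 1 fun y => by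
      rw [Real.norm_eq_abs, abs_of_pos (normalPDF_pos _)]
      exact normalPDF_le_one _
  set C := 2 * (2 * β / η + 8 / η ^ 2) / η + (2 * β / η + 8 / η ^ 2) ^ 2 with hC
  have hC0 : 0 ≤ C := by positivity
  have hf := tendsto_integral_rademacherSum_cltSteps b hν f
  have hg := tendsto_integral_rademacherSum_cltSteps b hν g
  have hsqrt : Tendsto (fun N : ℕ => (√(N : ℝ))⁻¹) atTop (𝓝 0) :=
    tendsto_inv_atTop_zero.comp (Real.tendsto_sqrt_atTop.comp tendsto_natCast_atTop_atTop)
  have hbσ : ∀ j i, |b j i| ≤ σ := fun j i => by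
    refine abs_le_of_sq_le_sq ?_ hσ.le
    exact (Finset.single_le_sum (f := fun j => b j i ^ 2) (fun _ _ => sq_nonneg _)
      (Finset.mem_univ j)).trans (hb i)
  have hgrad : ∀ y : EuclideanSpace ℝ ι,
      ∑ j, (∑ i, softMaxWeight β y.ofLp i * b j i) ^ 2 ≤ σ ^ 2 := by
    intro y
    calc ∑ j, (∑ i, softMaxWeight β y.ofLp i * b j i) ^ 2
        ≤ ∑ j, ∑ i, softMaxWeight β y.ofLp i * b j i ^ 2 := Finset.sum_le_sum fun j _ =>
          (even_two.convexOn_pow (𝕜 := ℝ)).map_sum_le (fun i _ => (softMaxWeight_pos β _ i).le)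
            (sum_softMaxWeight β _) (fun i _ => mem_univ _)
      _ = ∑ i, softMaxWeight β y.ofLp i * ∑ j, b j i ^ 2 := by
          rw [Finset.sum_comm]
          simp_rw [Finset.mul_sum]
      _ ≤ ∑ i, softMaxWeight β y.ofLp i * σ ^ 2 := Finset.sum_le_sum fun i _ =>
          mul_le_mul_of_nonneg_left (hb i) (softMaxWeight_pos β _ i).le
      _ = σ ^ 2 := by rw [← Finset.sum_mul, sum_softMaxWeight, one_mul]
  have hbound : ∀ᶠ N : ℕ in atTop,
      normalProfile (∫ y, f y ∂rademacherSum (cltSteps b N) 0) ≤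
        √(1 + σ ^ 2 / η ^ 2) * (∫ y, g y ∂rademacherSum (cltSteps b N) 0)
          + √(Fintype.card κ * C * σ ^ 3 * (√(N : ℝ))⁻¹) := by
    have h1 : ∀ᶠ N : ℕ in atTop, (√(N : ℝ))⁻¹ * σ < 1 :=
      (show Tendsto (fun N : ℕ => (√(N : ℝ))⁻¹ * σ) atTop (𝓝 0) by
        simpa using hsqrt.mul_const σ).eventually_lt_const one_pos
    have h2 : ∀ᶠ N : ℕ in atTop, 2 * β * ((√(N : ℝ))⁻¹ * σ) < 1 :=
      (show Tendsto (fun N : ℕ => 2 * β * ((√(N : ℝ))⁻¹ * σ)) atTop (𝓝 0) by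
        simpa using (hsqrt.mul_const σ).const_mul (2 * β)).eventually_lt_const one_pos
    filter_upwards [h1, h2, eventually_gt_atTop 0] with N h1 h2 hN
    set a := (√(N : ℝ))⁻¹ with ha
    have ha0 : 0 < a := by positivity
    have haN : N * a ^ 2 = 1 := by
      rw [ha, inv_pow, Real.sq_sqrt (Nat.cast_nonneg N), mul_inv_cancel₀ (by positivity)]
    let D : EuclideanSpace ℝ ι → EuclideanSpace ℝ ι → ℝ := fun h y =>
      (normalPDF (u y) / η) ^ 2 * (∑ i, softMaxWeight β y.ofLp i * h i) ^ 2 + C * (a * σ) ^ 3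
    have hstep : ∀ h ∈ cltSteps b N, ∀ y, ∀ c : ℝ, |c| = 2 →
        ((f y - f (y + c • h)) / 2) ^ 2 ≤ D h y := by
      intro h hh y c hc
      obtain ⟨j, rfl⟩ := exists_of_mem_cltSteps hh
      have := normalCDF_softMax_diff_sq_le (r := r) hβ hη y.ofLp (k := (c • a • b j).ofLp)
        (H := a * σ) (fun i => by
          simp only [PiLp.smul_apply, smul_eq_mul, abs_mul, hc, abs_of_pos ha0]
          have := hbσ j i
          gcongr) h2.le h1.le
      refine this.trans_eq ?_
      have hc2 : c ^ 2 = 4 := by rw [← sq_abs, hc]; norm_num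
      have : ∑ i, softMaxWeight β y.ofLp i * (c • a • b j).ofLp i
          = c * ∑ i, softMaxWeight β y.ofLp i * (a • b j).ofLp i := by
        rw [Finset.mul_sum]
        exact Finset.sum_congr rfl fun i _ => by simp; ring
      rw [this]
      simp only [D]
      rw [hC]
      linear_combination (normalPDF (u y) / η) ^ 2
        * (∑ i, softMaxWeight β y.ofLp i * (a • b j).ofLp i) ^ 2 / 4 * hc2
    have hcube := normalProfile_integral_rademacherSum_le (f := f) (D := D)
      (fun y => normalCDF_mem (u y)) (cltSteps b N)
      (fun h hh y => by
        have := hstep h hh y (-2) (by norm_num)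
        rwa [neg_smul, ← sub_eq_add_neg, ofNat_smul_eq_nsmul ℝ 2 h] at this)
      (fun h hh y => by
        have := hstep h hh y 2 (by norm_num)
        rwa [ofNat_smul_eq_nsmul ℝ 2 h] at this) 0
    refine hcube.trans ?_
    have hInt : ∀ F : EuclideanSpace ℝ ι → ℝ, Integrable F (rademacherSum (cltSteps b N) 0) :=
      fun F => integrable_rademacherSum _ _ F
    calc _ ≤ ∫ y, (√(1 + σ ^ 2 / η ^ 2) * g y + √(Fintype.card κ * C * σ ^ 3 * a))
          ∂rademacherSum (cltSteps b N) 0 := by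
          refine integral_mono (hInt _) (hInt _) fun y => ?_
          have hsum : ((cltSteps b N).map fun h => D h y).sum ≤
              (normalPDF (u y) / η) ^ 2 * σ ^ 2 + Fintype.card κ * C * σ ^ 3 * a := by
            rw [sum_map_cltSteps]
            calc ∑ j, N * D (a • b j) y
                = ∑ j, ((normalPDF (u y) / η) ^ 2 * (∑ i, softMaxWeight β y.ofLp i * b j i) ^ 2
                  + C * σ ^ 3 * a) := by
                  refine Finset.sum_congr rfl fun j _ => ?_
                  have : ∑ i, softMaxWeight β y.ofLp i * (a • b j).ofLp i
                      = a * ∑ i, softMaxWeight β y.ofLp i * b j i := by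
                    rw [Finset.mul_sum]
                    exact Finset.sum_congr rfl fun i _ => by simp; ring
                  simp only [D, this]
                  linear_combination ((normalPDF (u y) / η) ^ 2
                    * (∑ i, softMaxWeight β y.ofLp i * b j i) ^ 2 + C * σ ^ 3 * a) * haN
              _ = (normalPDF (u y) / η) ^ 2 * (∑ j, (∑ i, softMaxWeight β y.ofLp i * b j i) ^ 2)
                  + Fintype.card κ * C * σ ^ 3 * a := by
                  rw [Finset.sum_add_distrib, ← Finset.mul_sum]
                  simp
                  ring
              _ ≤ _ := by
                  have := hgrad y
                  gcongr
          have hφ := normalPDF_pos (u y)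
          have hfy : normalProfile (f y) = normalPDF (u y) :=
            congrArg normalPDF (normalQuantile_normalCDF _)
          calc √(normalProfile (f y) ^ 2 + ((cltSteps b N).map fun h => D h y).sum)
              ≤ √((1 + σ ^ 2 / η ^ 2) * normalPDF (u y) ^ 2 + Fintype.card κ * C * σ ^ 3 * a) := by
                apply Real.sqrt_le_sqrt
                rw [hfy]
                refine (add_le_add_right hsum _).trans_eq ?_
                ring
            _ ≤ √((1 + σ ^ 2 / η ^ 2) * normalPDF (u y) ^ 2)
                + √(Fintype.card κ * C * σ ^ 3 * a) := by
                refine Real.sqrt_le_iff.2 ⟨by positivity, ?_⟩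
                have hA : 0 ≤ (1 + σ ^ 2 / η ^ 2) * normalPDF (u y) ^ 2 := by positivity
                have hB : 0 ≤ Fintype.card κ * C * σ ^ 3 * a := by positivity
                rw [add_sq, Real.sq_sqrt hA, Real.sq_sqrt hB]
                have : 0 ≤ 2 * √((1 + σ ^ 2 / η ^ 2) * normalPDF (u y) ^ 2)
                  * √(Fintype.card κ * C * σ ^ 3 * a) := by positivity
                linarith
            _ = _ := by
                rw [Real.sqrt_mul (by positivity), Real.sqrt_sq hφ.le]
                rfl
      _ = _ := by
          rw [integral_add (hInt _) (hInt _), integral_const_mul]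
          simp
  have hlim := (hg.const_mul √(1 + σ ^ 2 / η ^ 2)).add
    ((hsqrt.const_mul (Fintype.card κ * C * σ ^ 3)).sqrt)
  rw [mul_zero, Real.sqrt_zero, add_zero] at hlim
  exact le_of_tendsto_of_tendsto
    ((hasDerivAt_normalProfile hmem).continuousAt.tendsto.comp hf) hlim hbound

/-! ### Growth of the quantiles -/

section Smoothing

variable {α : Type*} [MeasurableSpace α] {ν : Measure α} [IsProbabilityMeasure ν] {g : α → ℝ}

lemma integrable_normalCDF_comp (hg : Measurable g) : Integrable (fun y => normalCDF (g y)) ν :=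
  .of_bound (continuous_normalCDF.measurable.comp hg).aestronglyMeasurable 1 <|
    .of_forall fun y => by
      rw [Real.norm_eq_abs, abs_of_pos (normalCDF_mem _).1]
      exact (normalCDF_mem _).2.le

lemma integral_normalCDF_comp_pos (hg : Measurable g) : 0 < ∫ y, normalCDF (g y) ∂ν := by
  rw [integral_pos_iff_support_of_nonneg (fun y => (normalCDF_mem _).1.le)
    (integrable_normalCDF_comp hg), Function.support_eq_univ fun y => (normalCDF_mem (g y)).1.ne']
  simp

lemma integral_normalCDF_comp_mem (hg : Measurable g) :
    ∫ y, normalCDF (g y) ∂ν ∈ Ioo (0 : ℝ) 1 := by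
  refine ⟨integral_normalCDF_comp_pos hg, ?_⟩
  have h := integral_normalCDF_comp_pos (ν := ν) hg.neg
  simp only [Pi.neg_apply, normalCDF_neg] at h
  rw [integral_sub (integrable_const _) (integrable_normalCDF_comp hg)] at h
  simp at h
  exact h

lemma hasDerivAt_integral_normalCDF (hg : Measurable g) {η : ℝ} (hη : 0 < η) (r : ℝ) :
    HasDerivAt (fun r => ∫ y, normalCDF ((r - g y) / η) ∂ν)
      (∫ y, normalPDF ((r - g y) / η) * η⁻¹ ∂ν) r := by
  refine (hasDerivAt_integral_of_dominated_loc_of_deriv_le (bound := fun _ => η⁻¹)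
    (F' := fun r y => normalPDF ((r - g y) / η) * η⁻¹) univ_mem ?_ ?_ ?_ ?_
    (integrable_const _) ?_).2
  · exact .of_forall fun r => (integrable_normalCDF_comp (by fun_prop)).1
  · exact integrable_normalCDF_comp (by fun_prop)
  · exact ((continuous_normalPDF.measurable.comp (by fun_prop)).mul_const _).aestronglyMeasurable
  · refine .of_forall fun y r _ => ?_
    rw [norm_mul, Real.norm_eq_abs, Real.norm_eq_abs, abs_of_pos (normalPDF_pos _),
      abs_of_pos (inv_pos.2 hη)]
    exact mul_le_of_le_one_left (inv_pos.2 hη).le (normalPDF_le_one _)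
  · refine .of_forall fun y r _ => ?_
    refine (hasDerivAt_normalCDF _).comp r ?_
    simpa using ((hasDerivAt_id r).sub_const (g y)).div_const η

end Smoothing

lemma normalQuantile_integral_softMax_add_le {κ ι : Type*} [Fintype κ] [Fintype ι] [Nonempty ι]
    {b : κ → EuclideanSpace ℝ ι} {ν : Measure (EuclideanSpace ℝ ι)} [IsProbabilityMeasure ν]
    (hν : ∀ t, charFun ν t = Complex.exp (-((∑ j, inner ℝ (b j) t ^ 2 : ℝ) : ℂ) / 2))
    {σ β η u : ℝ} (hσ : 0 < σ) (hb : ∀ i, ∑ j, b j i ^ 2 ≤ σ ^ 2) (hβ : 0 < β) (hη : 0 < η)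
    (r : ℝ) (hu : 0 ≤ u) :
    normalQuantile (∫ y, normalCDF ((r - softMax β y.ofLp) / η) ∂ν) + u / √(η ^ 2 + σ ^ 2) ≤
      normalQuantile (∫ y, normalCDF ((r + u - softMax β y.ofLp) / η) ∂ν) := by
  have hg : Measurable fun y : EuclideanSpace ℝ ι => softMax β y.ofLp :=
    ((continuous_softMax β).comp (PiLp.continuous_ofLp 2 _)).measurable
  have hmem : ∀ r, ∫ y, normalCDF ((r - softMax β y.ofLp) / η) ∂ν ∈ Ioo (0 : ℝ) 1 := fun r =>
    integral_normalCDF_comp_mem (by fun_prop)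
  have hs : √(η ^ 2 + σ ^ 2) = √(1 + σ ^ 2 / η ^ 2) * η := by
    rw [← Real.sqrt_sq hη.le, ← Real.sqrt_mul (by positivity), Real.sqrt_sq hη.le]
    congr 1
    field_simp
  have hmono := monotone_of_hasDerivAt_nonneg
    (fun r => ((hasDerivAt_normalQuantile (hmem r)).comp r
      (hasDerivAt_integral_normalCDF hg hη r)).sub
        ((hasDerivAt_id r).div_const √(η ^ 2 + σ ^ 2)))
    (fun r => by
      have h := normalProfile_integral_softMax_le hν hσ hb hβ hη r (hmem r)
      have hI := normalProfile_pos (∫ y, normalCDF ((r - softMax β y.ofLp) / η) ∂ν)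
      rw [Pi.zero_apply, sub_nonneg, integral_mul_const, hs, inv_mul_eq_div, ← div_eq_mul_inv,
        div_div, div_le_div_iff₀ (by positivity) (by positivity)]
      nlinarith)
  have h := hmono (le_add_of_nonneg_right hu : r ≤ r + u)
  simp only [Pi.sub_apply, Function.comp_apply, id, add_div] at h
  linarith

/-! ### The deviation inequality -/

lemma half_mul_normalCDF_le_integral {α : Type*} [MeasurableSpace α] {ν : Measure α}
    [IsProbabilityMeasure ν] {g : α → ℝ} (hg : Measurable g) {s : Set α} (hs : MeasurableSet s)
    (hνs : 1 / 2 ≤ ν.real s) {c : ℝ} (hc : ∀ y ∈ s, c ≤ g y) :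
    1 / 2 * normalCDF c ≤ ∫ y, normalCDF (g y) ∂ν := by
  calc 1 / 2 * normalCDF c ≤ ν.real s * normalCDF c :=
        mul_le_mul_of_nonneg_right hνs (normalCDF_mem c).1.le
    _ = ∫ y, s.indicator (fun _ => normalCDF c) y ∂ν := by
        rw [integral_indicator_const _ hs, smul_eq_mul]
    _ ≤ _ := by
        refine integral_mono ((integrable_const _).indicator hs) (integrable_normalCDF_comp hg)
          fun y => ?_
        by_cases hy : y ∈ s
        · simpa [hy] using strictMono_normalCDF.monotone (hc y hy)
        · simpa [hy] using (normalCDF_mem (g y)).1.le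

lemma integral_normalCDF_le_add {α : Type*} [MeasurableSpace α] {ν : Measure α}
    [IsProbabilityMeasure ν] {g : α → ℝ} (hg : Measurable g) {s : Set α} (hs : MeasurableSet s)
    {c : ℝ} (hc : ∀ y ∉ s, g y ≤ c) :
    ∫ y, normalCDF (g y) ∂ν ≤ ν.real s + normalCDF c := by
  calc ∫ y, normalCDF (g y) ∂ν ≤ ∫ y, (s.indicator (fun _ => (1 : ℝ)) y + normalCDF c) ∂ν := by
        refine integral_mono (integrable_normalCDF_comp hg)
          (((integrable_const _).indicator hs).add (integrable_const _)) fun y => ?_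
        by_cases hy : y ∈ s
        · simpa [hy] using (normalCDF_mem (g y)).2.le.trans
            (le_add_of_nonneg_right (normalCDF_mem c).1.le)
        · simpa [hy] using strictMono_normalCDF.monotone (hc y hy)
    _ = _ := by
        rw [integral_add ((integrable_const _).indicator hs) (integrable_const _),
          integral_indicator_const _ hs]
        simp

lemma tendsto_normalCDF_atTop : Tendsto normalCDF atTop (𝓝 1) := tendsto_cdf_atTop _

lemma tendsto_normalCDF_atBot : Tendsto normalCDF atBot (𝓝 0) := tendsto_cdf_atBot _

lemma normalQuantile_one_half : normalQuantile (1 / 2) = 0 := by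
  rw [← normalCDF_zero, normalQuantile_normalCDF]

lemma measurable_sup' {ι : Type*} [Fintype ι] [Nonempty ι] :
    Measurable fun y : EuclideanSpace ℝ ι => Finset.univ.sup' Finset.univ_nonempty y.ofLp := by
  have h : Continuous fun y : EuclideanSpace ℝ ι =>
      Finset.univ.sup' Finset.univ_nonempty y.ofLp :=
    Continuous.finset_sup'_apply _ fun i _ => by fun_prop
  exact h.measurable

lemma normalCDF_le_measureReal_sup'_le {κ ι : Type*} [Fintype κ] [Fintype ι] [Nonempty ι]
    {b : κ → EuclideanSpace ℝ ι} {ν : Measure (EuclideanSpace ℝ ι)} [IsProbabilityMeasure ν]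
    (hν : ∀ t, charFun ν t = Complex.exp (-((∑ j, inner ℝ (b j) t ^ 2 : ℝ) : ℂ) / 2))
    {σ m u : ℝ} (hσ : 0 < σ) (hb : ∀ i, ∑ j, b j i ^ 2 ≤ σ ^ 2)
    (hm : 1 / 2 ≤ ν.real {y | Finset.univ.sup' Finset.univ_nonempty y.ofLp ≤ m}) (hu : 0 ≤ u) :
    normalCDF (u / σ) ≤ ν.real {y | Finset.univ.sup' Finset.univ_nonempty y.ofLp ≤ m + u} := by
  set M : EuclideanSpace ℝ ι → ℝ := fun y => Finset.univ.sup' Finset.univ_nonempty y.ofLp with hM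
  have hMmeas : Measurable M := measurable_sup'
  have hset : ∀ a, MeasurableSet {y | M y ≤ a} := fun a => hMmeas measurableSet_Iic
  have hg : ∀ β, Measurable fun y : EuclideanSpace ℝ ι => softMax β y.ofLp := fun β =>
    ((continuous_softMax β).comp (PiLp.continuous_ofLp 2 _)).measurable
  have key : ∀ δ > 0, normalCDF (u / σ) ≤ ν.real {y | M y ≤ m + u + 2 * δ} := by
    intro δ hδ
    have hbound : ∀ᶠ k : ℕ in atTop,
        normalCDF (normalQuantile (1 / 2 * normalCDF (k * δ - Real.log (Fintype.card ι)))
            + u / √((k : ℝ)⁻¹ ^ 2 + σ ^ 2)) ≤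
          ν.real {y | M y ≤ m + u + 2 * δ} + normalCDF (-(k * δ)) := by
      filter_upwards [eventually_gt_atTop 0] with k hk
      have hk' : (0 : ℝ) < k := Nat.cast_pos.2 hk
      have hlow := half_mul_normalCDF_le_integral (ν := ν)
        (g := fun y => (m + δ - softMax k y.ofLp) / (k : ℝ)⁻¹) (by fun_prop) (hset m) hm
        (c := k * δ - Real.log (Fintype.card ι)) fun y hy => by
          have := softMax_le hk' (x := y.ofLp) (M := m) fun i =>
            (Finset.le_sup' y.ofLp (Finset.mem_univ i)).trans hy
          rw [le_div_iff₀ (inv_pos.2 hk'), sub_mul, mul_right_comm, mul_inv_cancel₀ hk'.ne']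
          linarith
      have hup := integral_normalCDF_le_add (ν := ν)
        (g := fun y => (m + δ + u - softMax k y.ofLp) / (k : ℝ)⁻¹) (by fun_prop)
        (hset (m + u + 2 * δ)) (c := -(k * δ)) fun y hy => by
          have : M y ≤ softMax k y.ofLp := Finset.sup'_le _ _ fun i _ => le_softMax hk' _ i
          have hy' : m + u + 2 * δ < M y := not_le.1 hy
          rw [div_le_iff₀ (inv_pos.2 hk'), neg_mul, mul_right_comm, mul_inv_cancel₀ hk'.ne']
          linarith
      have hmem : ∀ r, ∫ y, normalCDF ((r - softMax k y.ofLp) / (k : ℝ)⁻¹) ∂ν ∈ Ioo (0 : ℝ) 1 :=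
        fun r => integral_normalCDF_comp_mem (by fun_prop)
      have hslope := normalQuantile_integral_softMax_add_le hν hσ hb hk' (inv_pos.2 hk') (m + δ) hu
      refine le_trans ?_ hup
      rw [← normalCDF_normalQuantile (hmem (m + δ + u))]
      refine strictMono_normalCDF.monotone (le_trans (add_le_add_left ?_ _) hslope)
      have hc := normalCDF_mem (k * δ - Real.log (Fintype.card ι))
      exact (normalQuantile_le_iff ⟨by linarith [hc.1], by linarith [hc.2]⟩ (hmem _)).2 hlow
    have hkδ : Tendsto (fun k : ℕ => (k : ℝ) * δ) atTop atTop :=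
      tendsto_natCast_atTop_atTop.atTop_mul_const hδ
    have hq : Tendsto (fun k : ℕ =>
        normalQuantile (1 / 2 * normalCDF (k * δ - Real.log (Fintype.card ι)))) atTop (𝓝 0) := by
      have h := (tendsto_normalCDF_atTop.comp
        (tendsto_atTop_add_const_right _ (-Real.log (Fintype.card ι)) hkδ)).const_mul (1 / 2)
      rw [mul_one] at h
      rw [← normalQuantile_one_half]
      exact (continuousAt_normalQuantile ⟨by norm_num, by norm_num⟩).tendsto.comp h
    have hu' : Tendsto (fun k : ℕ => u / √((k : ℝ)⁻¹ ^ 2 + σ ^ 2)) atTop (𝓝 (u / σ)) := by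
      have h := (((tendsto_inv_atTop_zero.comp
        (tendsto_natCast_atTop_atTop (R := ℝ))).pow 2).add_const (σ ^ 2)).sqrt
      rw [zero_pow two_ne_zero, zero_add, Real.sqrt_sq hσ.le] at h
      exact tendsto_const_nhds.div h hσ.ne'
    have hl := (continuous_normalCDF.tendsto _).comp (hq.add hu')
    have hr := (tendsto_normalCDF_atBot.comp
      (tendsto_neg_atTop_atBot.comp hkδ)).const_add (ν.real {y | M y ≤ m + u + 2 * δ})
    rw [zero_add] at hl
    rw [add_zero] at hr
    exact le_of_tendsto_of_tendsto hl hr hbound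
  have := Measure.isProbabilityMeasure_map (μ := ν) hMmeas.aemeasurable
  have hcdf : ∀ a, cdf (ν.map M) a = ν.real {y | M y ≤ a} := fun a => by
    rw [cdf_eq_real, map_measureReal_apply hMmeas measurableSet_Iic]
    rfl
  rw [← hcdf]
  refine ge_of_tendsto (((cdf (ν.map M)).right_continuous (m + u)).mono_left
    (nhdsWithin_mono _ Ioi_subset_Ici_self)) ?_
  filter_upwards [self_mem_nhdsWithin] with a ha
  rw [hcdf]
  have h := key ((a - (m + u)) / 2) (by linarith [mem_Ioi.1 ha])
  rwa [show m + u + 2 * ((a - (m + u)) / 2) = a by ring] at h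

/-! ### Gaussian vectors -/

lemma exists_charFun_map_toLp_eq {Ω ι : Type*} [MeasurableSpace Ω] [Fintype ι] {Q : Measure Ω}
    [IsProbabilityMeasure Q] {X : Ω → ι → ℝ} (hXmeas : ∀ i, Measurable fun ω => X ω i)
    (hXgauss : ∀ a : ι → ℝ, ∃ v : ℝ≥0,
      Measure.map (fun ω => ∑ i, a i * X ω i) Q = gaussianReal 0 v) :
    ∃ (k : ℕ) (b : Fin k → EuclideanSpace ℝ ι),
      (∀ t, charFun (Q.map fun ω => WithLp.toLp 2 (X ω)) t =
        Complex.exp (-((∑ j, inner ℝ (b j) t ^ 2 : ℝ) : ℂ) / 2)) ∧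
      ∀ i, ∑ j, b j i ^ 2 = variance (fun ω => X ω i) Q := by
  classical
  have hsum : ∀ a : ι → ℝ, Measurable fun ω => ∑ i, a i * X ω i := fun a => by fun_prop
  have hlaw : ∀ a : ι → ℝ, Q.map (fun ω => ∑ i, a i * X ω i) =
      gaussianReal 0 (variance (fun ω => ∑ i, a i * X ω i) Q).toNNReal := fun a => by
    obtain ⟨v, hv⟩ := hXgauss a
    have : variance (fun ω => ∑ i, a i * X ω i) Q = v := by
      rw [← variance_id_map (hsum a).aemeasurable, hv, variance_id_gaussianReal]
    rw [hv, this, Real.toNNReal_coe]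
  have hL2 : ∀ i, MemLp (fun ω => X ω i) 2 Q := fun i => by
    have h : MemLp id 2 (Q.map fun ω => X ω i) := by
      have := hlaw (Pi.single i 1)
      simp only [Pi.single_apply, ite_mul, one_mul, zero_mul, Finset.sum_ite_eq',
        Finset.mem_univ, if_true] at this
      rw [this]
      exact memLp_id_gaussianReal 2
    exact (memLp_map_measure_iff aestronglyMeasurable_id (hXmeas i).aemeasurable).1 h
  set S : Matrix ι ι ℝ := .of fun i j => covariance (fun ω => X ω i) (fun ω => X ω j) Q with hS
  have hvar : ∀ a : ι → ℝ, variance (fun ω => ∑ i, a i * X ω i) Q = ∑ i, ∑ j, a i * a j * S i j :=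
    fun a => by
      rw [variance_fun_sum fun i => (hL2 i).const_mul (a i)]
      refine Finset.sum_congr rfl fun i _ => Finset.sum_congr rfl fun j _ => ?_
      rw [covariance_const_mul_left, covariance_const_mul_right, hS, Matrix.of_apply, mul_assoc]
  have hpos : S.PosSemidef := by
    refine Matrix.posSemidef_iff_dotProduct_mulVec.2 ⟨?_, fun a => ?_⟩
    · ext i j
      simp [hS, covariance_comm]
    · have h := variance_nonneg (fun ω => ∑ i, a i * X ω i) Q
      rw [hvar] at h
      refine h.trans_eq ?_
      simp [dotProduct, Matrix.mulVec, Finset.mul_sum]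
      exact Finset.sum_congr rfl fun i _ => Finset.sum_congr rfl fun j _ => by ring
  obtain ⟨k, w, hw⟩ := Matrix.posSemidef_iff_eq_sum_vecMulVec.1 hpos
  have hSw : ∀ i j, S i j = ∑ l, w l i * w l j := fun i j => by
    rw [hw, Matrix.sum_apply]
    simp [Matrix.vecMulVec_apply]
  refine ⟨k, fun l => WithLp.toLp 2 (w l), fun t => ?_, fun i => ?_⟩
  · have hv : variance (fun ω => ∑ i, t i * X ω i) Q =
        ∑ l, inner ℝ (WithLp.toLp 2 (w l)) t ^ 2 := by
      have hsq : ∀ l, inner ℝ (WithLp.toLp 2 (w l)) t ^ 2 =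
          ∑ i, ∑ j, t i * t j * (w l i * w l j) := fun l => by
        rw [PiLp.inner_apply, sq, Finset.sum_mul_sum]
        refine Finset.sum_congr rfl fun i _ => Finset.sum_congr rfl fun j _ => ?_
        simp only [RCLike.inner_apply, conj_trivial]
        ring
      simp_rw [hsq, hvar, hSw, Finset.mul_sum]
      rw [Finset.sum_comm (s := (Finset.univ : Finset (Fin k)))]
      exact Finset.sum_congr rfl fun i _ => Finset.sum_comm
    have hX : Measurable fun ω => WithLp.toLp 2 (X ω) :=
      (PiLp.continuous_toLp 2 _).measurable.comp (measurable_pi_iff.2 hXmeas)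
    have h1 : charFun (Q.map fun ω => WithLp.toLp 2 (X ω)) t =
        charFun (Q.map fun ω => ∑ i, t i * X ω i) 1 := by
      rw [charFun_apply, charFun_apply, integral_map hX.aemeasurable (by fun_prop),
        integral_map (hsum t).aemeasurable (by fun_prop)]
      simp [PiLp.inner_apply]
    rw [h1, hlaw, charFun_gaussianReal, ← hv]
    have hcoe : ((variance (fun ω => ∑ i, t i * X ω i) Q).toNNReal : ℝ) =
        variance (fun ω => ∑ i, t i * X ω i) Q := Real.coe_toNNReal _ (variance_nonneg _ _)
    congr 1
    rw [← hcoe]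
    simp [neg_div]
  · rw [← covariance_self (hXmeas i).aemeasurable]
    change _ = S i i
    simp [hSw, sq]

/-- Borell-TIS inequality, median form (B.1), for a finite index set:
if `X` is a centered Gaussian random vector in `ℝⁿ`, `σ² = maxᵢ Var(Xᵢ)` with `σ > 0`,
and `m` is a median of `maxᵢ Xᵢ`, then for every `u ≥ 0`,
`P(maxᵢ Xᵢ > u + m) ≤ 1 − Φ(u/σ)` where `Φ` is the standard normal CDF. -/
theorem borell_TIS_median {Ω : Type*} [MeasurableSpace Ω] (Q : Measure Ω)
    [IsProbabilityMeasure Q] {n : ℕ} [NeZero n]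
    (X : Ω → Fin n → ℝ) (hXmeas : ∀ i, Measurable fun ω => X ω i)
    (hXgauss : ∀ a : Fin n → ℝ, ∃ v : ℝ≥0,
      Measure.map (fun ω => ∑ i, a i * X ω i) Q = gaussianReal 0 v)
    (σ : ℝ) (hσ : 0 < σ)
    (hσ2 : σ ^ 2 = Finset.univ.sup' Finset.univ_nonempty
      fun i => variance (fun ω => X ω i) Q)
    (m : ℝ)
    (hm1 : (1 : ℝ≥0∞) / 2 ≤
      Q {ω | Finset.univ.sup' Finset.univ_nonempty (fun i => X ω i) ≤ m})
    (hm2 : (1 : ℝ≥0∞) / 2 ≤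
      Q {ω | m ≤ Finset.univ.sup' Finset.univ_nonempty (fun i => X ω i)})
    (u : ℝ) (hu : 0 ≤ u) :
    (Q {ω | u + m < Finset.univ.sup' Finset.univ_nonempty (fun i => X ω i)}).toReal
      ≤ 1 - cdf (gaussianReal 0 1) (u / σ) := by
  obtain ⟨k, b, hcf, hb⟩ := exists_charFun_map_toLp_eq hXmeas hXgauss
  have hX : Measurable fun ω => WithLp.toLp 2 (X ω) :=
    (PiLp.continuous_toLp 2 _).measurable.comp (measurable_pi_iff.2 hXmeas)
  have := Measure.isProbabilityMeasure_map (μ := Q) hX.aemeasurable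
  have hmap : ∀ a, (Q.map fun ω => WithLp.toLp 2 (X ω)).real
      {y | Finset.univ.sup' Finset.univ_nonempty y.ofLp ≤ a} =
        Q.real {ω | Finset.univ.sup' Finset.univ_nonempty (fun i => X ω i) ≤ a} := fun a =>
    map_measureReal_apply hX (measurable_sup' measurableSet_Iic)
  have h := normalCDF_le_measureReal_sup'_le (m := m) hcf hσ
    (fun i => (hb i).trans_le (hσ2 ▸ Finset.le_sup' (fun i => variance (fun ω => X ω i) Q)
      (Finset.mem_univ i)))
    (by
      rw [hmap, Measure.real, ← ENNReal.toReal_one, ← ENNReal.toReal_ofNat 2, ← ENNReal.toReal_div]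
      exact ENNReal.toReal_mono (measure_ne_top _ _) hm1) hu
  rw [hmap, add_comm m u] at h
  have hmeas : MeasurableSet
      {ω | Finset.univ.sup' Finset.univ_nonempty (fun i => X ω i) ≤ u + m} :=
    hX (measurable_sup' measurableSet_Iic)
  have hcompl : {ω | u + m < Finset.univ.sup' Finset.univ_nonempty fun i => X ω i} =
      {ω | Finset.univ.sup' Finset.univ_nonempty (fun i => X ω i) ≤ u + m}ᶜ := by
    ext ω
    simp only [mem_ofPred_eq, mem_compl_iff, not_le]
  rw [hcompl]
  change Q.real _ ≤ _
  rw [probReal_compl_eq_one_sub hmeas]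
  exact sub_le_sub_left h 1
end
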